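/- Kernel-form product formula for two Gegenbauer functions of the second kind. Let λ, α ∈ ℂ with Re(λ+2α) > 0, and let z₁, z₂ be real numbers with z₁ > 1 and z₂ > 1. Assume that the function z₃ ↦ D_λ^α(z₃) · ((z₁²+z₂²+z₃²−1)/(2z₁z₂) − z₃)^{α−1} is absolutely integrable on (z₁z₂ + √((z₁²−1)(z₂²−1)), ∞) (note that (z₁²+z₂²+z₃²−1)/(2z₁z₂) − z₃ > 0 on this range). Then D_λ^α(z₁) · D_λ^α(z₂) = [e^{iπα} Γ(λ+2α) (z₁z₂)^{α−1}] / [2^α Γ(λ+1) Γ(α)² (z₁²−1)^{α−1/2} (z₂²−1)^{α−1/2}] × ∫_{z₁z₂+√((z₁²−1)(z₂²−1))}^∞ D_λ^α(z₃) · ((z₁²+z₂²+z₃²−1)/(2z₁z₂) − z₃)^{α−1} dz₃. -/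

import Mathlib

open MeasureTheory Set

/-- The regularized Gauss hypergeometric function `₂F̃₁(a,b;c;z)`. -/
noncomputable def hyp2F1reg (a b c z : ℂ) : ℂ :=
  ∑' n : ℕ, (ascPochhammer ℂ n).eval a * (ascPochhammer ℂ n).eval b /
      (Complex.Gamma (c + n) * (n.factorial : ℂ)) * z ^ n

/-- The Jacobi function of the second kind `Q_γ^{(α,β)}(z)` for real `z > 1`. -/
noncomputable def jacobiQ (α β γ : ℂ) (z : ℝ) : ℂ :=
  (2 : ℂ) ^ (α + β + γ) * Complex.Gamma (α + γ + 1) * Complex.Gamma (β + γ + 1) *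
    ((z : ℂ) - 1) ^ (-α) * ((z : ℂ) + 1) ^ (-β - γ - 1) *
    hyp2F1reg (γ + 1) (β + γ + 1) (α + β + 2 * γ + 2) (2 / (1 + (z : ℂ)))

/-- The Jacobi function of the first kind `P_γ^{(α,β)}(z)` for real `z > 1`. -/
noncomputable def jacobiP (α β γ : ℂ) (z : ℝ) : ℂ :=
  Complex.Gamma (α + γ + 1) / Complex.Gamma (γ + 1) * (((z : ℂ) + 1) / 2) ^ γ *
    hyp2F1reg (-γ) (-β - γ) (α + 1) (((z : ℂ) - 1) / ((z : ℂ) + 1))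

/-- The Jacobi function of the first kind on the cut `𝖯_γ^{(α,β)}(x)`, `x ∈ (−1,1)`. -/
noncomputable def jacobiPcut (α β γ : ℂ) (x : ℝ) : ℂ :=
  Complex.Gamma (α + γ + 1) / Complex.Gamma (γ + 1) *
    hyp2F1reg (-γ) (α + β + γ + 1) (α + 1) ((1 - (x : ℂ)) / 2)

/-- The Gegenbauer function of the first kind `C_λ^α(z)` for real `z > 1`. -/
noncomputable def gegenbauerC (lam α : ℂ) (z : ℝ) : ℂ :=
  (Real.sqrt Real.pi : ℂ) * Complex.Gamma (lam + 2 * α) /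
      ((2 : ℂ) ^ (2 * α - 1) * Complex.Gamma α * Complex.Gamma (lam + 1)) *
    (((z : ℂ) + 1) / 2) ^ lam *
    hyp2F1reg (-lam) (1 / 2 - α - lam) (α + 1 / 2) (((z : ℂ) - 1) / ((z : ℂ) + 1))

/-- The Gegenbauer function of the first kind on the cut `𝖢_λ^α(x)`, `x ∈ (−1,1)`. -/
noncomputable def gegenbauerCcut (lam α : ℂ) (x : ℝ) : ℂ :=
  (Real.sqrt Real.pi : ℂ) * Complex.Gamma (lam + 2 * α) /
      ((2 : ℂ) ^ (2 * α - 1) * Complex.Gamma α * Complex.Gamma (lam + 1)) *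
    hyp2F1reg (-lam) (lam + 2 * α) (α + 1 / 2) ((1 - (x : ℂ)) / 2)

/-- The Gegenbauer function of the second kind `D_λ^α(z)` for real `z > 1`. -/
noncomputable def gegenbauerD (lam α : ℂ) (z : ℝ) : ℂ :=
  Complex.exp ((Real.pi : ℂ) * Complex.I * α) * (Complex.Gamma (lam + 2 * α) / Complex.Gamma α) *
    (2 * (z : ℂ)) ^ (-lam - 2 * α) *
    hyp2F1reg (lam / 2 + α) (lam / 2 + α + 1 / 2) (lam + α + 1) (1 / (z : ℂ) ^ 2)

/-- The associated Legendre function of the second kind `Q_ν^μ(z)` for real `z > 1`. -/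
noncomputable def legendreQ (ν μ : ℂ) (z : ℝ) : ℂ :=
  (Real.sqrt Real.pi : ℂ) * Complex.exp ((Real.pi : ℂ) * Complex.I * μ) *
    Complex.Gamma (ν + μ + 1) * ((z : ℂ) ^ 2 - 1) ^ (μ / 2) * (2 : ℂ) ^ (-ν - 1) *
    (z : ℂ) ^ (-ν - μ - 1) *
    hyp2F1reg ((ν + μ + 1) / 2) ((ν + μ + 2) / 2) (ν + 3 / 2) (1 / (z : ℂ) ^ 2)

/-- The Legendre function of the first kind `P_ν(z)` for real `z ≥ 1`. -/
noncomputable def legendreP (ν : ℂ) (z : ℝ) : ℂ :=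
  (((z : ℂ) + 1) / 2) ^ ν * hyp2F1reg (-ν) (-ν) 1 (((z : ℂ) - 1) / ((z : ℂ) + 1))

/-- The associated Legendre function of the first kind of order `−μ`, `P_ν^{−μ}(z)`, `z > 1`. -/
noncomputable def legendrePa (ν μ : ℂ) (z : ℝ) : ℂ :=
  (((z : ℂ) - 1) / ((z : ℂ) + 1)) ^ (μ / 2) * (((z : ℂ) + 1) / 2) ^ ν *
    hyp2F1reg (-ν) (μ - ν) (μ + 1) (((z : ℂ) - 1) / ((z : ℂ) + 1))

/-- The Ferrers function of the first kind of order `−μ`, `𝖯_ν^{−μ}(x)`, `x ∈ (−1,1)`. -/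
noncomputable def ferrersP (ν μ : ℂ) (x : ℝ) : ℂ :=
  ((1 - (x : ℂ)) / (1 + (x : ℂ))) ^ (μ / 2) * hyp2F1reg (-ν) (ν + 1) (1 + μ) ((1 - (x : ℂ)) / 2)

/-- The Ferrers function of the second kind of order `−μ`, `𝖰_ν^{−μ}(x)`, `x ∈ (−1,1)`. -/
noncomputable def ferrersQ (ν μ : ℂ) (x : ℝ) : ℂ :=
  -((Real.pi : ℂ) / (2 * Complex.sin ((Real.pi : ℂ) * μ))) *
    (Complex.cos ((Real.pi : ℂ) * (ν - μ)) *
        (Complex.Gamma (ν - μ + 1) / Complex.Gamma (ν + μ + 1)) *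
        ((1 + (x : ℂ)) / (1 - (x : ℂ))) ^ (-μ / 2) *
        hyp2F1reg (-ν) (ν + 1) (1 - μ) ((1 + (x : ℂ)) / 2) -
      Complex.cos ((Real.pi : ℂ) * ν) * ((1 - (x : ℂ)) / (1 + (x : ℂ))) ^ (-μ / 2) *
        hyp2F1reg (-ν) (ν + 1) (1 + μ) ((1 + (x : ℂ)) / 2))

open Filter Topology
open MeasureTheory Set Filter Topology

lemma kp_tendsto_ratio (a c : ℂ) :
    Tendsto (fun n : ℕ => (a + n) / (c + n)) atTop (𝓝 1) := by
  have h0 : Tendsto (fun n : ℕ => ‖c + (n : ℂ)‖) atTop atTop := by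
    have h1 : Tendsto (fun n : ℕ => (n : ℝ) - ‖c‖) atTop atTop :=
      tendsto_atTop_add_const_right _ _ tendsto_natCast_atTop_atTop
    refine tendsto_atTop_mono (fun n => ?_) h1
    have := norm_sub_norm_le (n : ℂ) (-c)
    rw [norm_neg, sub_neg_eq_add, add_comm (n : ℂ) c] at this
    simpa using this
  have h1 : Tendsto (fun n : ℕ => (c + (n : ℂ))⁻¹) atTop (𝓝 0) := by
    rw [tendsto_zero_iff_norm_tendsto_zero]
    simp_rw [norm_inv]
    exact h0.inv_tendsto_atTop
  have h2 : Tendsto (fun n : ℕ => 1 + (a - c) * (c + (n : ℂ))⁻¹) atTop (𝓝 (1 + (a - c) * 0)) :=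
    tendsto_const_nhds.add (tendsto_const_nhds.mul h1)
  rw [mul_zero, add_zero] at h2
  refine h2.congr' ?_
  filter_upwards [h0.eventually_gt_atTop 0] with n hn
  have : c + (n : ℂ) ≠ 0 := norm_pos_iff.mp hn
  field_simp
  ring

lemma kp_summable_of_ratio (f g : ℕ → ℂ) (hg : Tendsto g atTop (𝓝 1))
    (hf : ∀ᶠ n in atTop, f (n + 1) = g n * f n) {r : ℝ} (h0 : 0 ≤ r) (h1 : r < 1) :
    Summable fun n => ‖f n‖ * r ^ n := by
  obtain ⟨s, hs1, hs2⟩ := exists_between h1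
  have h2 : Tendsto (fun n => ‖g n‖ * r) atTop (𝓝 (‖(1 : ℂ)‖ * r)) :=
    hg.norm.mul tendsto_const_nhds
  rw [norm_one, one_mul] at h2
  refine summable_of_ratio_norm_eventually_le hs2 ?_
  filter_upwards [hf, h2.eventually_lt_const hs1] with n hn hn2
  rw [hn]
  simp only [norm_mul, norm_norm, norm_pow, Real.norm_of_nonneg h0]
  calc ‖g n‖ * ‖f n‖ * r ^ (n + 1) = (‖g n‖ * r) * (‖f n‖ * r ^ n) := by ring
    _ ≤ _ := by gcongr

/-- Hypergeometric coefficients. -/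
noncomputable def kpHC (a b c : ℂ) (n : ℕ) : ℂ :=
  (ascPochhammer ℂ n).eval a * (ascPochhammer ℂ n).eval b /
      (Complex.Gamma (c + n) * (n.factorial : ℂ))

lemma kpHC_rec (a b c : ℂ) (n : ℕ) :
    ((n : ℂ) + 1) * (c + n) * kpHC a b c (n + 1) = (a + n) * (b + n) * kpHC a b c n := by
  unfold kpHC
  rw [ascPochhammer_succ_eval, ascPochhammer_succ_eval, Nat.factorial_succ]
  push_cast
  rw [← add_assoc c]
  have hn : (n : ℂ) + 1 ≠ 0 := by exact_mod_cast Nat.succ_ne_zero n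
  have hf : (n.factorial : ℂ) ≠ 0 := by exact_mod_cast n.factorial_ne_zero
  by_cases h : c + n = 0
  · have : Complex.Gamma (c + n) = 0 := by rw [h, Complex.Gamma_zero]
    rw [this, h]; simp
  · rw [Complex.Gamma_add_one _ h]
    by_cases hG : Complex.Gamma (c + n) = 0
    · simp [hG]
    · field_simp

lemma kp_eventually_ne (c : ℂ) : ∀ᶠ n : ℕ in atTop, c + n ≠ 0 := by
  filter_upwards [eventually_gt_atTop ⌈‖c‖⌉₊] with n hn h
  have h1 : (n : ℂ) = -c := by linear_combination h
  have h2 : (n : ℝ) = ‖c‖ := by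
    rw [← norm_neg c, ← h1]; simp
  have := Nat.le_ceil ‖c‖
  rw [← h2] at this
  rw [← h2] at hn
  simp at hn

lemma kpHC_summable (a b c : ℂ) {r : ℝ} (h0 : 0 ≤ r) (h1 : r < 1) :
    Summable fun n => ‖kpHC a b c n‖ * r ^ n := by
  refine kp_summable_of_ratio _ (fun n : ℕ => ((a + n) / (1 + n)) * ((b + n) / (c + n))) ?_ ?_ h0 h1
  · simpa using (kp_tendsto_ratio a 1).mul (kp_tendsto_ratio b c)
  · filter_upwards [kp_eventually_ne c] with n hn
    have hn' : (1 : ℂ) + n ≠ 0 := by exact_mod_cast (by omega : 1 + n ≠ 0)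
    have := kpHC_rec a b c n
    rw [div_mul_div_comm, div_mul_eq_mul_div, eq_div_iff (mul_ne_zero hn' hn), ← this]
    ring

lemma kp_beta (l α : ℂ) (hl : -1 < l.re) (hα : 0 < α.re) (m : ℕ) :
    ∫ v in Ioo (0 : ℝ) 1, (v : ℂ) ^ l * ((1 - v : ℝ) : ℂ) ^ (α - 1) * (v : ℂ) ^ m =
      Complex.Gamma (l + m + 1) * Complex.Gamma α / Complex.Gamma (l + m + 1 + α) := by
  have h1 : 0 < (l + m + 1).re := by
    simp; have : (0 : ℝ) ≤ m := Nat.cast_nonneg m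
    linarith
  rw [Complex.Gamma_mul_Gamma_eq_betaIntegral h1 hα, mul_div_cancel_left₀]
  · rw [Complex.betaIntegral, intervalIntegral.integral_of_le zero_le_one,
      integral_Ioc_eq_integral_Ioo]
    refine setIntegral_congr_fun measurableSet_Ioo (fun v hv => ?_)
    have hv0 : (v : ℂ) ≠ 0 := by exact_mod_cast hv.1.ne'
    rw [show l + m + 1 - 1 = l + m by ring, Complex.cpow_add _ _ hv0, Complex.cpow_natCast]
    push_cast
    ring
  · refine Complex.Gamma_ne_zero_of_re_pos ?_
    rw [Complex.add_re]; positivity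

lemma kp_beta_int (l α : ℂ) (hl : -1 < l.re) (hα : 0 < α.re) :
    IntegrableOn (fun v : ℝ => (v : ℂ) ^ l * ((1 - v : ℝ) : ℂ) ^ (α - 1)) (Ioo 0 1) := by
  have h1 : 0 < (l + 1).re := by simp; linarith
  have := (intervalIntegrable_iff_integrableOn_Ioo_of_le zero_le_one).mp
    (Complex.betaIntegral_convergent h1 hα)
  simpa using this

/-- Base case: termwise integration. -/
lemma kp_powint_base (l α : ℂ) (hl : -1 < l.re) (hα : 0 < α.re) (φ : ℕ → ℂ)
    (hφ : Summable fun m => ‖φ m‖) :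
    HasSum (fun m : ℕ => φ m * (Complex.Gamma (l + m + 1) * Complex.Gamma α /
        Complex.Gamma (l + m + 1 + α)))
      (∫ v in Ioo (0 : ℝ) 1, (v : ℂ) ^ l * ((1 - v : ℝ) : ℂ) ^ (α - 1) *
        ∑' m, φ m * (v : ℂ) ^ m) := by
  have hint := kp_beta_int l α hl hα
  have hb : ∀ m : ℕ, ∀ v ∈ Ioo (0 : ℝ) 1, ‖φ m * (v : ℂ) ^ m‖ ≤ ‖φ m‖ := by
    intro m v hv
    rw [norm_mul, norm_pow, Complex.norm_real, Real.norm_of_nonneg hv.1.le]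
    exact mul_le_of_le_one_right (norm_nonneg _) (pow_le_one₀ hv.1.le hv.2.le)
  have hi : ∀ m : ℕ, IntegrableOn (fun v : ℝ => (v : ℂ) ^ l * ((1 - v : ℝ) : ℂ) ^ (α - 1) *
      (φ m * (v : ℂ) ^ m)) (Ioo 0 1) := by
    intro m
    refine Integrable.mul_bdd (c := ‖φ m‖) hint ?_ ?_
    · exact (Continuous.aestronglyMeasurable (by fun_prop))
    · exact (ae_restrict_iff' measurableSet_Ioo).mpr (Eventually.of_forall (hb m))
  have key := hasSum_integral_of_summable_integral_norm (μ := volume.restrict (Ioo (0:ℝ) 1)) hi ?_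
  · have e1 : (∫ v in Ioo (0 : ℝ) 1, (v : ℂ) ^ l * ((1 - v : ℝ) : ℂ) ^ (α - 1) *
        ∑' m, φ m * (v : ℂ) ^ m) = ∫ v in Ioo (0 : ℝ) 1, ∑' m,
          (v : ℂ) ^ l * ((1 - v : ℝ) : ℂ) ^ (α - 1) * (φ m * (v : ℂ) ^ m) := by
      congr 1; ext v; rw [tsum_mul_left]
    rw [e1]
    refine key.congr_fun ?_
    intro m
    rw [← kp_beta l α hl hα m, ← integral_const_mul]
    congr 1; ext v; ring
  · refine Summable.of_nonneg_of_le (fun m => integral_nonneg fun _ => norm_nonneg _) (fun m => ?_)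
      (hφ.mul_right (∫ v in Ioo (0 : ℝ) 1, ‖(v : ℂ) ^ l * ((1 - v : ℝ) : ℂ) ^ (α - 1)‖))
    rw [← integral_const_mul]
    refine setIntegral_mono_on (hi m).norm (hint.norm.const_mul _) measurableSet_Ioo
      (fun v hv => ?_)
    rw [norm_mul, mul_comm]
    exact mul_le_mul_of_nonneg_right (hb m v hv) (norm_nonneg _)


lemma kp_nonint (α : ℂ) (g : ℝ → ℂ) (hg : ContinuousAt g 1) (h1 : g 1 ≠ 0)
    (hint : IntegrableOn (fun v : ℝ => g v * ((1 - v : ℝ) : ℂ) ^ (α - 1)) (Ioo 0 1)) :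
    0 < α.re := by
  set ε := ‖g 1‖ / 2 with hε
  have hε0 : 0 < ε := by have := norm_pos_iff.mpr h1; positivity
  have hlt : ε < ‖g 1‖ := by have := norm_pos_iff.mpr h1; rw [hε]; linarith
  obtain ⟨δ, hδ, hball⟩ := Metric.eventually_nhds_iff.mp (hg.norm.eventually_const_lt hlt)
  set d := min δ 1 with hd
  have hd0 : 0 < d := lt_min hδ one_pos
  have hd1 : d ≤ 1 := min_le_right _ _
  have i1 : IntegrableOn (fun v : ℝ => (1 - v) ^ (α.re - 1)) (Ioo (1 - d) 1) := by
    have i0 := ((hint.mono_set (Ioo_subset_Ioo_left (by linarith : (0:ℝ) ≤ 1 - d))).norm.const_mul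
      ε⁻¹)
    refine Integrable.mono' i0 ?_ ?_
    · exact (Measurable.aestronglyMeasurable (by fun_prop))
    · refine (ae_restrict_iff' measurableSet_Ioo).mpr (Eventually.of_forall fun v hv => ?_)
      have hv1 : 0 < 1 - v := by linarith [hv.2]
      rw [norm_mul, Complex.norm_cpow_eq_rpow_re_of_pos hv1, Real.norm_of_nonneg (by positivity)]
      have hgv : ε < ‖g v‖ := hball (by
        rw [Real.dist_eq, abs_lt]
        constructor
        · linarith [hv.1, min_le_left δ 1]
        · linarith [hv.2])
      simp only [Complex.sub_re, Complex.one_re]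
      rw [← mul_assoc]
      refine le_mul_of_one_le_left (by positivity) ?_
      rw [inv_mul_eq_div, one_le_div hε0]
      exact hgv.le
  have i2 : IntegrableOn (fun u : ℝ => u ^ (α.re - 1)) (Ioo 0 d) := by
    have := (integrableOn_image_iff_integrableOn_abs_deriv_smul (s := Ioo (0:ℝ) d)
      (f := fun u => 1 - u) (f' := fun _ => -1) measurableSet_Ioo
      (fun x _ => by simpa using ((hasDerivAt_id x).const_sub 1).hasDerivWithinAt)
      (fun x _ y _ h => by simpa using h) (fun v : ℝ => (1 - v) ^ (α.re - 1))).mp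
    simp only [image_const_sub_Ioo, sub_zero] at this
    simpa using this i1
  have := (intervalIntegral.integrableOn_Ioo_rpow_iff hd0).mp i2
  linarith

lemma kp_abel (φ ψ b : ℕ → ℂ) (h0 : ψ 0 = φ 0) (hs : ∀ m, ψ (m + 1) = ψ m + φ (m + 1))
    (h1 : Summable fun m => ψ m * b m) (h2 : Summable fun m => ψ m * b (m + 1)) :
    HasSum (fun m => φ m * b m) (∑' m, ψ m * (b m - b (m + 1))) := by
  have e : ∑' m, ψ m * (b m - b (m + 1)) = ∑' m, ψ m * b m - ∑' m, ψ m * b (m + 1) := by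
    rw [← h1.tsum_sub h2]; simp_rw [mul_sub]
  rw [e]
  have h3 : HasSum (fun m => (Nat.casesOn m 0 (fun k => ψ k * b (k + 1)) : ℂ))
      (∑' m, ψ m * b (m + 1)) := by
    refine (hasSum_nat_add_iff' 1).mp ?_
    simpa using h2.hasSum
  refine (h1.hasSum.sub h3).congr_fun ?_
  intro m
  cases m with
  | zero => simp [h0]
  | succ k => simp only [hs]; ring

noncomputable def kpB (l α : ℂ) (m : ℕ) : ℂ :=
  Complex.Gamma (l + m + 1) * Complex.Gamma α / Complex.Gamma (l + m + 1 + α)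

lemma kp_Ginv (s : ℂ) : (Complex.Gamma s)⁻¹ = s * (Complex.Gamma (s + 1))⁻¹ := by
  have := Complex.one_div_Gamma_eq_self_mul_one_div_Gamma_add_one s
  simpa using this

lemma kpB_pascal (l α : ℂ) (hl : -1 < l.re) (h0 : α ≠ 0) (m : ℕ) :
    kpB l α m - kpB l α (m + 1) = kpB l (α + 1) m := by
  have hm : l + m + 1 ≠ 0 := by
    intro h
    have := congrArg Complex.re h
    simp at this
    have hh : (0 : ℝ) ≤ m := Nat.cast_nonneg m
    linarith
  unfold kpB
  push_cast
  rw [show l + ((m : ℂ) + 1) + 1 = (l + m + 1) + 1 by ring, Complex.Gamma_add_one _ hm,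
    Complex.Gamma_add_one _ h0, div_eq_mul_inv, kp_Ginv (l + m + 1 + α), div_eq_mul_inv,
    div_eq_mul_inv, show l + ↑m + 1 + 1 + α = l + m + 1 + α + 1 by ring,
    show l + ↑m + 1 + (α + 1) = l + m + 1 + α + 1 by ring]
  ring

lemma kpB_summable (l α : ℂ) (hl : -1 < l.re) {r : ℝ} (h0 : 0 ≤ r) (h1 : r < 1) :
    Summable fun m => ‖kpB l α m‖ * r ^ m := by
  refine kp_summable_of_ratio _ (fun n : ℕ => ((l + 1 + n) / (l + 1 + α + n))) ?_ ?_ h0 h1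
  · exact kp_tendsto_ratio _ _
  · filter_upwards [kp_eventually_ne (l + 1 + α)] with m hn
    have hm : l + m + 1 ≠ 0 := by
      intro h
      have := congrArg Complex.re h
      simp at this
      have hh : (0 : ℝ) ≤ m := Nat.cast_nonneg m
      linarith
    unfold kpB
    push_cast
    rw [show l + ((m : ℂ) + 1) + 1 = (l + m + 1) + 1 by ring, Complex.Gamma_add_one _ hm,
      show l + ↑m + 1 + 1 + α = l + 1 + α + m + 1 by ring, Complex.Gamma_add_one _ hn,
      show l + ↑m + 1 + α = l + 1 + α + m by ring]
    by_cases hG : Complex.Gamma (l + 1 + α + m) = 0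
    · simp [hG]
    field_simp
    ring

/-- General termwise integration, with the endpoint `v = 1` handled by Abel summation. -/
lemma kp_powint (l : ℂ) (hl : -1 < l.re) : ∀ k : ℕ, ∀ α : ℂ, -(k : ℝ) < α.re →
    (∀ j : ℕ, α ≠ -j) → ∀ φ : ℕ → ℂ, (∃ r : ℝ, 1 < r ∧ Summable fun m => ‖φ m‖ * r ^ m) →
    IntegrableOn (fun v : ℝ => (v : ℂ) ^ l * ((1 - v : ℝ) : ℂ) ^ (α - 1) *
        ∑' m, φ m * (v : ℂ) ^ m) (Ioo 0 1) →
    HasSum (fun m : ℕ => φ m * kpB l α m)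
      (∫ v in Ioo (0 : ℝ) 1, (v : ℂ) ^ l * ((1 - v : ℝ) : ℂ) ^ (α - 1) *
        ∑' m, φ m * (v : ℂ) ^ m) := by
  intro k
  induction k with
  | zero =>
    rintro α hα - φ ⟨r, hr, hs⟩ -
    refine kp_powint_base l α hl (by simpa using hα) φ ?_
    refine Summable.of_nonneg_of_le (fun m => norm_nonneg _) (fun m => ?_) hs
    exact le_mul_of_one_le_right (norm_nonneg _) (one_le_pow₀ hr.le)
  | succ k ih =>
    rintro α hα hαj φ ⟨r, hr, hs⟩ hint
    have hs1 : Summable fun m => ‖φ m‖ := by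
      refine Summable.of_nonneg_of_le (fun m => norm_nonneg _) (fun m => ?_) hs
      exact le_mul_of_one_le_right (norm_nonneg _) (one_le_pow₀ hr.le)
    by_cases hpos : 0 < α.re
    · exact kp_powint_base l α hl hpos φ hs1
    have hr0 : 0 < r := by linarith
    have hΦ1 : ∑' m, φ m = 0 := by
      by_contra hne
      apply hpos
      refine kp_nonint α (fun v : ℝ => (v : ℂ) ^ l * ∑' m, φ m * (v : ℂ) ^ m) ?_ ?_ ?_
      · refine ContinuousAt.mul ?_ ?_
        · refine ContinuousAt.cpow (by fun_prop) continuousAt_const ?_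
          simp
        · have : ContinuousOn (fun v : ℝ => ∑' m, φ m * (v : ℂ) ^ m) (Icc (-r) r) := by
            refine continuousOn_tsum (fun m => by fun_prop) hs (fun m v hv => ?_)
            rw [norm_mul, norm_pow, Complex.norm_real, Real.norm_eq_abs]
            gcongr
            exact abs_le.mpr hv
          exact this.continuousAt (Icc_mem_nhds (by linarith) hr)
      · simpa using hne
      · refine hint.congr_fun (fun v _ => ?_) measurableSet_Ioo
        ring
    set ψ : ℕ → ℂ := fun m => ∑ j ∈ Finset.range (m + 1), φ j with hψ
    have hψ0 : ψ 0 = φ 0 := by simp [hψ]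
    have hψs : ∀ m, ψ (m + 1) = ψ m + φ (m + 1) := fun m => by
      simp only [hψ]; rw [Finset.sum_range_succ]
    set C := ∑' m, ‖φ m‖ * r ^ m with hC
    have hC0 : 0 ≤ C := tsum_nonneg fun m => by positivity
    have hψb : ∀ m, ‖ψ m‖ * r ^ m ≤ C := by
      intro m
      have e1 : ψ m = - ∑' j, φ (j + (m + 1)) := by
        have := hs1.of_norm.sum_add_tsum_nat_add (m + 1)
        rw [hΦ1] at this
        linear_combination this
      have hs2 := (summable_nat_add_iff (m + 1)).mpr hs1
      have hs3 := (summable_nat_add_iff (m + 1)).mpr hs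
      rw [e1, norm_neg]
      calc ‖∑' j, φ (j + (m + 1))‖ * r ^ m ≤ (∑' j, ‖φ (j + (m + 1))‖) * r ^ m := by
            gcongr; exact norm_tsum_le_tsum_norm hs2
        _ = ∑' j, ‖φ (j + (m + 1))‖ * r ^ m := by rw [tsum_mul_right]
        _ ≤ ∑' j, ‖φ (j + (m + 1))‖ * r ^ (j + (m + 1)) := by
            refine Summable.tsum_le_tsum (fun j => ?_) (hs2.mul_right _) hs3
            gcongr
            · exact hr.le
            · omega
        _ ≤ C := by
            rw [hC, ← hs.sum_add_tsum_nat_add (m + 1)]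
            exact le_add_of_nonneg_left (Finset.sum_nonneg fun i _ => by positivity)
    have hψb' : ∀ m, ‖ψ m‖ ≤ C * r⁻¹ ^ m := by
      intro m
      rw [inv_pow, ← div_eq_mul_inv, le_div_iff₀ (by positivity)]
      exact hψb m
    have hri : r⁻¹ < 1 := inv_lt_one_of_one_lt₀ hr
    have hri0 : 0 ≤ r⁻¹ := by positivity
    have gen : ∀ b : ℕ → ℂ, (Summable fun m => ‖b m‖ * r⁻¹ ^ m) →
        Summable fun m => ψ m * b m := by
      intro b hb
      refine Summable.of_norm_bounded (hb.mul_left C) (fun m => ?_)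
      rw [norm_mul]
      calc ‖ψ m‖ * ‖b m‖ ≤ (C * r⁻¹ ^ m) * ‖b m‖ := by gcongr; exact hψb' m
        _ = _ := by ring
    have shift : ∀ b : ℕ → ℂ, (Summable fun m => ‖b m‖ * r⁻¹ ^ m) →
        Summable fun m => ‖b (m + 1)‖ * r⁻¹ ^ m := by
      intro b hb
      have := ((summable_nat_add_iff 1).mpr hb).mul_right r
      refine this.congr (fun m => ?_)
      rw [pow_succ]
      field_simp
    have fact1 : ∀ v ∈ Ioo (0:ℝ) 1, ∑' m, φ m * (v : ℂ) ^ m =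
        ((1 - v : ℝ) : ℂ) * ∑' m, ψ m * (v : ℂ) ^ m := by
      intro v hv
      have hb : Summable fun m : ℕ => ‖(v : ℂ) ^ m‖ * r⁻¹ ^ m := by
        simp_rw [norm_pow, ← mul_pow]
        refine summable_geometric_of_lt_one (by positivity) ?_
        rw [Complex.norm_real, Real.norm_of_nonneg hv.1.le]
        calc v * r⁻¹ < 1 * 1 := by
              apply mul_lt_mul'' hv.2 hri hv.1.le hri0
          _ = 1 := by ring
      have := (kp_abel φ ψ (fun m => (v : ℂ) ^ m) hψ0 hψs (gen _ hb) (gen _ (shift _ hb))).tsum_eq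
      rw [this, ← tsum_mul_left]
      congr 1; ext m; push_cast; ring
    have fact2 : EqOn (fun v : ℝ => (v : ℂ) ^ l * ((1 - v : ℝ) : ℂ) ^ (α - 1) *
        ∑' m, φ m * (v : ℂ) ^ m) (fun v : ℝ => (v : ℂ) ^ l * ((1 - v : ℝ) : ℂ) ^ (α + 1 - 1) *
        ∑' m, ψ m * (v : ℂ) ^ m) (Ioo 0 1) := by
      intro v hv
      have h1v : ((1 - v : ℝ) : ℂ) ≠ 0 := by
        exact_mod_cast (by linarith [hv.2] : (0:ℝ) < 1 - v).ne'
      simp only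
      rw [fact1 v hv, show α + 1 - 1 = (α - 1) + 1 by ring, Complex.cpow_add _ _ h1v,
        Complex.cpow_one]
      ring
    rw [setIntegral_congr_fun measurableSet_Ioo fact2]
    have hα0 : α ≠ 0 := by simpa using hαj 0
    have key := ih (α + 1) (by push_cast at hα; simp; linarith) (fun j h => hαj (j + 1) (by
      push_cast; linear_combination h)) ψ ?_ (hint.congr_fun fact2 measurableSet_Ioo)
    · rw [← key.tsum_eq]
      have hB := kpB_summable l α hl hri0 hri
      have := kp_abel φ ψ (kpB l α) hψ0 hψs (gen _ hB) (gen _ (shift _ hB))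
      simpa only [kpB_pascal l α hl hα0] using this
    · obtain ⟨t, ht1, ht2⟩ := exists_between hr
      refine ⟨t, ht1, ?_⟩
      have ht0 : 0 < t := by linarith
      have : Summable fun m : ℕ => C * (r⁻¹ * t) ^ m := by
        refine (summable_geometric_of_lt_one (by positivity) ?_).mul_left C
        rw [inv_mul_eq_div, div_lt_one hr0]; exact ht2
      refine Summable.of_nonneg_of_le (fun m => by positivity) (fun m => ?_) this
      rw [mul_pow, ← mul_assoc]
      gcongr
      exact hψb' m


lemma kp_deriv_summable (b : ℕ → ℂ) (R : ℝ)
    (hb : ∀ r : ℝ, 0 ≤ r → r < R → Summable fun k => ‖b k‖ * r ^ k) :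
    ∀ r : ℝ, 0 ≤ r → r < R → Summable fun k : ℕ => ‖((k : ℂ) + 1) * b (k + 1)‖ * r ^ k := by
  intro r h0 h1
  obtain ⟨s, hs1, hs2⟩ := exists_between h1
  have hs0 : 0 < s := h0.trans_lt hs1
  have h2 := (summable_nat_add_iff 1).mpr (hb s hs0.le hs2)
  have hq : r / s < 1 := (div_lt_one hs0).mpr hs1
  have hq0 : 0 ≤ r / s := by positivity
  have h3 : Tendsto (fun k : ℕ => ((k : ℝ) + 1) * (r / s) ^ k) atTop (𝓝 0) := by
    have h4 := tendsto_self_mul_const_pow_of_lt_one hq0 hq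
    have h5 := tendsto_pow_atTop_nhds_zero_of_lt_one hq0 hq
    have := h4.add h5
    rw [add_zero] at this
    refine this.congr fun k => by ring
  have h6 : ∀ᶠ k : ℕ in atTop, ((k : ℝ) + 1) * (r / s) ^ k < s := h3.eventually_lt_const hs0
  refine Summable.of_norm_bounded_eventually_nat h2 ?_
  filter_upwards [h6] with k hk
  have h7 : ‖(k : ℂ) + 1‖ = (k : ℝ) + 1 := by
    rw [show (k : ℂ) + 1 = ((k + 1 : ℕ) : ℂ) by push_cast; ring, Complex.norm_natCast]
    push_cast; ring
  rw [norm_mul, norm_norm, norm_mul, h7, Real.norm_of_nonneg (by positivity)]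
  have h8 : r ^ k = (r / s) ^ k * s ^ k := by rw [div_pow]; field_simp
  calc ((k : ℝ) + 1) * ‖b (k + 1)‖ * r ^ k
      = ‖b (k + 1)‖ * s ^ k * (((k : ℝ) + 1) * (r / s) ^ k) := by rw [h8]; ring
    _ ≤ ‖b (k + 1)‖ * s ^ k * s := by gcongr
    _ = _ := by ring

lemma kp_hasDeriv (b : ℕ → ℂ) (R : ℝ)
    (hb : ∀ r : ℝ, 0 ≤ r → r < R → Summable fun k => ‖b k‖ * r ^ k) (y : ℂ) (hy : ‖y‖ < R) :
    HasDerivAt (fun y : ℂ => ∑' k, b k * y ^ k)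
      (∑' k : ℕ, (((k : ℂ) + 1) * b (k + 1)) * y ^ k) y := by
  obtain ⟨r, hr1, hr2⟩ := exists_between hy
  have hr0 : 0 < r := (norm_nonneg y).trans_lt hr1
  have hd := kp_deriv_summable b R hb r hr0.le hr2
  have hu : Summable fun k : ℕ => ‖(k : ℂ) * b k‖ * r ^ (k - 1) := by
    rw [← summable_nat_add_iff 1]
    refine hd.congr fun k => by push_cast; simp
  have hD : ∀ k : ℕ, ∀ x ∈ Metric.ball (0 : ℂ) r,
      HasDerivAt (fun x : ℂ => b k * x ^ k) ((k : ℂ) * b k * x ^ (k - 1)) x := by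
    intro k x _
    have := (hasDerivAt_pow k x).const_mul (b k)
    refine this.congr_deriv (by ring)
  have h := hasDerivAt_tsum_of_isPreconnected hu Metric.isOpen_ball
    (convex_ball (0 : ℂ) r).isPreconnected hD (fun k x hx => by
      rw [norm_mul, norm_pow]
      have : ‖x‖ < r := by simpa using hx
      gcongr) (Metric.mem_ball_self hr0) (by
        refine summable_of_ne_finset_zero (s := {0}) fun k hk => ?_
        have : k ≠ 0 := by simpa using hk
        simp [this]) (y := y) (by simpa using hr1)
  refine h.congr_deriv ?_
  have hs : Summable fun k : ℕ => (k : ℂ) * b k * y ^ (k - 1) := by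
    refine Summable.of_norm_bounded hu fun k => ?_
    rw [norm_mul, norm_pow]; gcongr
  rw [hs.tsum_eq_zero_add]
  simp

lemma kp_summable_ps (b : ℕ → ℂ) (R : ℝ)
    (hb : ∀ r : ℝ, 0 ≤ r → r < R → Summable fun k => ‖b k‖ * r ^ k) (y : ℂ) (hy : ‖y‖ < R) :
    Summable fun k => b k * y ^ k := by
  refine Summable.of_norm ?_
  refine (hb ‖y‖ (norm_nonneg y) hy).congr fun k => by rw [norm_mul, norm_pow]

lemma kp_hasSum_congr {ι : Type*} {f g : ι → ℂ} {a : ℂ} (h : HasSum f a) (e : ∀ k, f k = g k) :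
    HasSum g a := by
  have : f = g := funext e
  rwa [this] at h

lemma kp_const_of_deriv (f : ℝ → ℂ) (hc : ContinuousAt f 0)
    (hd : ∀ x ∈ Ioo (0 : ℝ) 1, HasDerivAt f 0 x) : ∀ x ∈ Ioo (0 : ℝ) 1, f x = f 0 := by
  intro x hx
  obtain ⟨C, hC⟩ := isOpen_Ioo.exists_is_const_of_deriv_eq_zero (𝕜 := ℝ)
    (isPreconnected_Ioo (a := (0 : ℝ)) (b := 1))
    (fun x hx => (hd x hx).differentiableAt.differentiableWithinAt)
    (fun x hx => (hd x hx).deriv)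
  have h1 : Tendsto f (𝓝[>] 0) (𝓝 (f 0)) := hc.tendsto.mono_left nhdsWithin_le_nhds
  have h2 : Tendsto f (𝓝[>] 0) (𝓝 C) := by
    refine tendsto_const_nhds.congr' ?_
    filter_upwards [Ioo_mem_nhdsGT (show (0 : ℝ) < 1 by norm_num)] with y hy
    exact (hC y hy).symm
  rw [hC x hx, tendsto_nhds_unique h1 h2]

/-- Generalized Catalan coefficients. -/
noncomputable def kpCat (s : ℂ) (k : ℕ) : ℂ :=
  (ascPochhammer ℂ k).eval (s + k + 1) / (k.factorial : ℂ)

lemma kpCat_rec (s : ℂ) (k : ℕ) :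
    ((k : ℂ) + 1) * (s + k + 1) * kpCat s (k + 1) =
      (s + 2 * k + 1) * (s + 2 * k + 2) * kpCat s k := by
  unfold kpCat
  have h1 : (ascPochhammer ℂ (k + 2)).eval (s + k + 1) =
      (s + k + 1) * (ascPochhammer ℂ (k + 1)).eval (s + k + 1 + 1) := by
    rw [ascPochhammer_succ_left]; simp
  rw [ascPochhammer_succ_eval, ascPochhammer_succ_eval] at h1
  have hn : (k : ℂ) + 1 ≠ 0 := by exact_mod_cast Nat.succ_ne_zero k
  have hf : (k.factorial : ℂ) ≠ 0 := by exact_mod_cast k.factorial_ne_zero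
  rw [Nat.factorial_succ]
  push_cast
  push_cast at h1
  rw [show s + ((k : ℂ) + 1) + 1 = s + k + 1 + 1 by ring]
  field_simp
  rw [← h1]; ring

lemma kpCat_summable (s : ℂ) (hs : -1 < s.re) (r : ℝ) (h0 : 0 ≤ r) (h1 : r < 1 / 4) :
    Summable fun k => ‖kpCat s k‖ * r ^ k := by
  have h := kp_summable_of_ratio (fun k => kpCat s k / 4 ^ k)
    (fun k => (((s + 1) / 2 + k) / (1 + k)) * (((s + 2) / 2 + k) / (s + 1 + k)))
    (by simpa using (kp_tendsto_ratio ((s + 1) / 2) 1).mul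
          (kp_tendsto_ratio ((s + 2) / 2) (s + 1)))
    (Eventually.of_forall fun k => by
      have hn : 1 + (k : ℂ) ≠ 0 := by
        rw [add_comm]; exact_mod_cast Nat.succ_ne_zero k
      have hs' : s + 1 + (k : ℂ) ≠ 0 := by
        intro h
        have := congrArg Complex.re h
        simp at this
        have hk : (0 : ℝ) ≤ k := Nat.cast_nonneg k
        linarith
      have h := kpCat_rec s k
      rw [pow_succ]
      have : kpCat s (k + 1) = (s + 2 * k + 1) * (s + 2 * k + 2) * kpCat s k /
          ((1 + (k : ℂ)) * (s + 1 + k)) := by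
        rw [eq_div_iff (mul_ne_zero hn hs'), ← h]; ring
      rw [this]
      field_simp
      ring) (r := 4 * r) (by linarith) (by linarith)
  refine h.congr fun k => ?_
  rw [norm_div, mul_pow]
  simp only [norm_pow, RCLike.norm_ofNat]
  field_simp

lemma kp_shift (g : ℕ → ℂ) (y S : ℂ) (h0 : g 0 = 0) (h : HasSum (fun k => g (k + 1) * y ^ k) S) :
    HasSum (fun k => g k * y ^ k) (y * S) := by
  have := (hasSum_nat_add_iff (f := fun k => g k * y ^ k) 1 (g := y * S)).mp
    (kp_hasSum_congr (h.mul_left y) fun k => by ring)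
  simpa [h0] using this

lemma kpCat_ode (s : ℂ) (hs : -1 < s.re) (y : ℂ) (hy : ‖y‖ < 1 / 4) :
    y * (1 - 4 * y) * (∑' k : ℕ, (((k : ℂ) + 1) * (((k + 1 : ℕ) : ℂ) + 1) * kpCat s (k + 1 + 1)) * y ^ k)
     + ((s + 1) - (4 * s + 10) * y) * (∑' k : ℕ, (((k : ℂ) + 1) * kpCat s (k + 1)) * y ^ k)
     - (s + 1) * (s + 2) * (∑' k : ℕ, kpCat s k * y ^ k) = 0 := by
  have hb0 := kpCat_summable s hs
  have hb1 := kp_deriv_summable _ _ hb0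
  have hb2 := kp_deriv_summable _ _ hb1
  have h0 := (kp_summable_ps _ _ hb0 y hy).hasSum
  have h1 := (kp_summable_ps _ _ hb1 y hy).hasSum
  have h2 := (kp_summable_ps _ _ hb2 y hy).hasSum
  simp only [← mul_assoc] at h2
  set B0 := ∑' k : ℕ, kpCat s k * y ^ k
  set B1 := ∑' k : ℕ, (((k : ℂ) + 1) * kpCat s (k + 1)) * y ^ k
  set B2 := ∑' k : ℕ, (((k : ℂ) + 1) * (((k + 1 : ℕ) : ℂ) + 1) * kpCat s (k + 1 + 1)) * y ^ k
  have e1 := kp_shift (fun k => (k : ℂ) * kpCat s k) y B1 (by simp) (by push_cast; exact h1)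
  have e2 := kp_shift (fun k => (k : ℂ) * ((k : ℂ) + 1) * kpCat s (k + 1)) y B2 (by simp)
    (by push_cast; push_cast at h2; exact h2)
  have e3 := kp_shift (fun k => (k : ℂ) * ((k : ℂ) - 1) * kpCat s k) y (y * B2) (by simp)
    (by push_cast; refine kp_hasSum_congr e2 fun k => by ring)
  have := (((e2.sub (e3.mul_left 4)).add (h1.mul_left (s + 1))).sub
    (e1.mul_left (4 * s + 10))).sub (h0.mul_left ((s + 1) * (s + 2)))

  have h4 : HasSum (fun _ : ℕ => (0 : ℂ)) _ := kp_hasSum_congr this fun k => by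
    have := kpCat_rec s k
    linear_combination (y ^ k) * this
  have h5 := h4.unique hasSum_zero
  linear_combination h5

lemma kp_catalan (s : ℂ) (hs : -1 < s.re) (X : ℝ) (hX : X ∈ Ioo (0 : ℝ) 1) :
    HasSum (fun k => kpCat s k * ((X / (1 + X) ^ 2 : ℝ) : ℂ) ^ k)
      (((1 + X : ℝ) : ℂ) ^ (s + 1) / ((1 - X : ℝ) : ℂ)) := by
  have hb0 := kpCat_summable s hs
  have hb1 := kp_deriv_summable _ _ hb0
  set B0 : ℂ → ℂ := fun y => ∑' k : ℕ, kpCat s k * y ^ k with hB0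
  set B1 : ℂ → ℂ := fun y => ∑' k : ℕ, (((k : ℂ) + 1) * kpCat s (k + 1)) * y ^ k with hB1
  set B2 : ℂ → ℂ := fun y =>
    ∑' k : ℕ, (((k : ℂ) + 1) * (((k + 1 : ℕ) : ℂ) + 1) * kpCat s (k + 1 + 1)) * y ^ k with hB2
  have d0 : ∀ y : ℂ, ‖y‖ < 1 / 4 → HasDerivAt B0 (B1 y) y := kp_hasDeriv _ _ hb0
  have d1 : ∀ y : ℂ, ‖y‖ < 1 / 4 → HasDerivAt B1 (B2 y) y := by
    intro y hy
    have := kp_hasDeriv _ _ hb1 y hy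
    simpa only [← mul_assoc] using this
  set Y : ℂ → ℂ := fun z => z / (1 + z) ^ 2 with hY
  have hYn : ∀ x : ℝ, x ∈ Ico (0 : ℝ) 1 → ‖Y x‖ < 1 / 4 := by
    intro x hx
    have : Y x = ((x / (1 + x) ^ 2 : ℝ) : ℂ) := by simp [hY]
    have hx0 := hx.1
    rw [this, Complex.norm_real, Real.norm_of_nonneg (by positivity),
      div_lt_div_iff₀ (by positivity) (by norm_num)]
    nlinarith [hx.2, sq_pos_of_pos (sub_pos.mpr hx.2)]
  have h1x : ∀ x : ℝ, x ∈ Ico (0 : ℝ) 1 → (1 + (x : ℂ)) ≠ 0 := by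
    intro x hx h
    have := congrArg Complex.re h
    simp at this
    linarith [hx.1]
  have dY : ∀ x : ℝ, x ∈ Ico (0 : ℝ) 1 →
      HasDerivAt Y ((1 - (x : ℂ)) / (1 + x) ^ 3) x := by
    intro x hx
    have h1 := h1x x hx
    have := (hasDerivAt_id (x : ℂ)).div (((hasDerivAt_id (x : ℂ)).const_add 1).pow 2)
      (by simpa using h1)
    refine this.congr_deriv ?_
    simp
    field_simp
    ring
  set P : ℂ → ℂ := fun z => (1 + z) ^ (-s - 1) with hP
  have dP : ∀ x : ℝ, x ∈ Ico (0 : ℝ) 1 →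
      HasDerivAt P ((-s - 1) * P x / (1 + x)) x := by
    intro x hx
    have h1 := h1x x hx
    have := ((hasDerivAt_id (x : ℂ)).const_add 1).cpow_const (c := -s - 1) (by
      left
      have := hx.1
      simp; linarith)
    refine this.congr_deriv ?_
    simp only [hP, id, mul_one]
    rw [Complex.cpow_sub _ _ h1, Complex.cpow_one]
    ring
  set h : ℂ → ℂ := fun z => B0 (Y z) * (1 - z) * P z with hh
  set E : ℂ → ℂ := fun z => B1 (Y z) * ((1 - z) ^ 2 / (1 + z) ^ 3)
    + B0 (Y z) * (-1 - (s + 1) * ((1 - z) / (1 + z))) with hE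
  have dB0 : ∀ x : ℝ, x ∈ Ico (0 : ℝ) 1 →
      HasDerivAt (fun z => B0 (Y z)) (B1 (Y x) * ((1 - (x : ℂ)) / (1 + x) ^ 3)) x :=
    fun x hx => (d0 _ (hYn x hx)).comp (x : ℂ) (dY x hx)
  have dB1 : ∀ x : ℝ, x ∈ Ico (0 : ℝ) 1 →
      HasDerivAt (fun z => B1 (Y z)) (B2 (Y x) * ((1 - (x : ℂ)) / (1 + x) ^ 3)) x :=
    fun x hx => (d1 _ (hYn x hx)).comp (x : ℂ) (dY x hx)
  have dh : ∀ x : ℝ, x ∈ Ico (0 : ℝ) 1 → HasDerivAt h (P x * E x) x := by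
    intro x hx
    have h1 := h1x x hx
    have := ((dB0 x hx).mul ((hasDerivAt_id (x : ℂ)).const_sub 1)).mul (dP x hx)
    refine this.congr_deriv ?_
    simp only [hE, id, Pi.mul_apply]
    field_simp
    ring
  have dE : ∀ x : ℝ, x ∈ Ico (0 : ℝ) 1 → HasDerivAt E
      (B2 (Y x) * ((1 - (x : ℂ)) / (1 + x) ^ 3) * ((1 - x) ^ 2 / (1 + x) ^ 3)
        + B1 (Y x) * (-2 * (1 - x) / (1 + x) ^ 3 - 3 * (1 - x) ^ 2 / (1 + x) ^ 4)
        + B1 (Y x) * ((1 - (x : ℂ)) / (1 + x) ^ 3) * (-1 - (s + 1) * ((1 - x) / (1 + x)))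
        + B0 (Y x) * (2 * (s + 1) / (1 + x) ^ 2)) x := by
    intro x hx
    have h1 := h1x x hx
    have a1 := ((((hasDerivAt_id (x : ℂ)).const_sub 1).pow 2).div
      (((hasDerivAt_id (x : ℂ)).const_add 1).pow 3) (by simpa using h1))
    have a2 := (((((hasDerivAt_id (x : ℂ)).const_sub 1)).div
      (((hasDerivAt_id (x : ℂ)).const_add 1)) (by simpa using h1)).const_mul (s + 1)).const_sub
        (-1)
    have := ((dB1 x hx).mul a1).add ((dB0 x hx).mul a2)
    refine this.congr_deriv ?_
    simp
    field_simp
    ring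
  have hs1 : 0 < (s + 1).re := by simp; linarith
  have hs1' : s + 1 ≠ 0 := by
    intro h; rw [h] at hs1; simp at hs1
  set Q : ℝ → ℂ := fun x => (x : ℂ) ^ (s + 1) * (P x * E x) with hQ
  have hI : (0 : ℝ) ∈ Ico (0 : ℝ) 1 := by simp
  have hQc : ContinuousAt Q 0 := by
    refine (Complex.continuousAt_ofReal_cpow_const 0 _ (Or.inl hs1)).mul ?_
    exact (((dP 0 hI).comp_ofReal).mul ((dE 0 hI).comp_ofReal)).continuousAt
  have hQ0 : ∀ x ∈ Ioo (0 : ℝ) 1, Q x = 0 := by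
    intro x hx
    rw [kp_const_of_deriv Q hQc ?_ x hx]
    · simp [hQ, Complex.zero_cpow hs1']
    · intro x hx
      have hx' := Ioo_subset_Ico_self hx
      have h1 := h1x x hx'
      have hx0 : (x : ℂ) ≠ 0 := by exact_mod_cast hx.1.ne'
      have b1 := ((hasDerivAt_id (x : ℂ)).cpow_const (c := s + 1) (by
        left; simpa using hx.1)).comp_ofReal
      have := b1.mul (((dP x hx').comp_ofReal).mul ((dE x hx').comp_ofReal))
      refine this.congr_deriv ?_
      have hode := kpCat_ode s hs (Y x) (hYn x hx')
      change Y x * (1 - 4 * Y x) * B2 (Y x) + ((s + 1) - (4 * s + 10) * Y x) * B1 (Y x)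
        - (s + 1) * (s + 2) * B0 (Y x) = 0 at hode
      have e1 : (x : ℂ) ^ (s + 1) = x ^ s * x := by
        rw [Complex.cpow_add _ _ hx0, Complex.cpow_one]
      simp only [hE, id, Pi.mul_apply, add_sub_cancel_right, e1]
      have eY : Y x = x / (1 + x) ^ 2 := rfl
      generalize B0 (Y x) = u0 at *
      generalize B1 (Y x) = u1 at *
      generalize B2 (Y x) = u2 at *
      generalize P x = p at *
      generalize (x : ℂ) ^ s = xs at *
      rw [eY] at hode
      generalize (x : ℂ) = z at *
      have : p * xs * (1 - z) / (1 + z) ^ 2 * (z / (1 + z) ^ 2 * (1 - 4 * (z / (1 + z) ^ 2)) * u2 +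
        ((s + 1) - (4 * s + 10) * (z / (1 + z) ^ 2)) * u1 - (s + 1) * (s + 2) * u0) = 0 := by
        rw [hode, mul_zero]
      rw [← this]
      field_simp
      ring
  have hE0 : ∀ x ∈ Ioo (0 : ℝ) 1, P x * E x = 0 := by
    intro x hx
    have := hQ0 x hx
    rcases mul_eq_zero.mp this with h | h
    · exfalso
      rw [Complex.cpow_eq_zero_iff] at h
      exact hx.1.ne' (by exact_mod_cast h.1)
    · exact h
  have hconst := kp_const_of_deriv (fun x : ℝ => h x) (dh 0 hI).comp_ofReal.continuousAt
    (fun x hx => by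
      have := (dh x (Ioo_subset_Ico_self hx)).comp_ofReal
      rwa [hE0 x hx] at this) X hX
  have hX' := Ioo_subset_Ico_self hX
  have hsum := (kp_summable_ps _ _ hb0 (Y X) (hYn X hX')).hasSum
  have e0 : h ((0 : ℝ) : ℂ) = 1 := by
    have : B0 0 = 1 := by
      simp only [hB0]
      rw [tsum_eq_single 0 (by intro k hk; simp [hk])]
      simp [kpCat]
    simp [hh, hY, hP, this]
  simp only [e0] at hconst
  have h1 := h1x X hX'
  have hX1 : (1 - (X : ℂ)) ≠ 0 := by
    intro h
    have := congrArg Complex.re h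
    simp at this
    linarith [hX.2]
  have e1 : ((X / (1 + X) ^ 2 : ℝ) : ℂ) = Y X := by simp [hY]
  rw [e1]
  convert hsum using 1
  change _ = B0 (Y X)
  have hPne : P X ≠ 0 := by
    simp only [hP]
    rw [Ne, Complex.cpow_eq_zero_iff]
    tauto
  have hPP : (1 + (X : ℂ)) ^ (s + 1) * P X = 1 := by
    simp only [hP]
    rw [← Complex.cpow_add _ _ h1]; simp
  push_cast
  rw [div_eq_iff hX1]
  have : B0 (Y X) * (1 - X) * P X = 1 := hconst
  linear_combination (-(1 + (X : ℂ)) ^ (s + 1)) * this + (B0 (Y X) * (1 - X)) * hPP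

lemma kp_binom_rec (a : ℂ) (n : ℕ) :
    ((n : ℂ) + 1) * kpHC a 1 1 (n + 1) = (a + n) * kpHC a 1 1 n := by
  have h := kpHC_rec a 1 1 n
  have hn : 1 + (n : ℂ) ≠ 0 := by
    rw [add_comm]; exact_mod_cast Nat.succ_ne_zero n
  refine mul_left_cancel₀ hn ?_
  linear_combination h

lemma kp_binom (a : ℂ) (X : ℝ) (hX : X ∈ Ioo (0 : ℝ) 1) :
    HasSum (fun k => kpHC a 1 1 k * (X : ℂ) ^ k) (((1 - X : ℝ) : ℂ) ^ (-a)) := by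
  have hb0 : ∀ r : ℝ, 0 ≤ r → r < 1 → Summable fun k => ‖kpHC a 1 1 k‖ * r ^ k :=
    fun r h0 h1 => kpHC_summable a 1 1 h0 h1
  have hb1 := kp_deriv_summable _ _ hb0
  set B0 : ℂ → ℂ := fun y => ∑' k : ℕ, kpHC a 1 1 k * y ^ k with hB0
  set B1 : ℂ → ℂ := fun y => ∑' k : ℕ, (((k : ℂ) + 1) * kpHC a 1 1 (k + 1)) * y ^ k with hB1
  have d0 : ∀ y : ℂ, ‖y‖ < 1 → HasDerivAt B0 (B1 y) y := kp_hasDeriv _ _ hb0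
  have hode : ∀ y : ℂ, ‖y‖ < 1 → (1 - y) * B1 y = a * B0 y := by
    intro y hy
    have h0 := (kp_summable_ps _ _ hb0 y hy).hasSum
    have h1 := (kp_summable_ps _ _ hb1 y hy).hasSum
    have e1 := kp_shift (fun k => (k : ℂ) * kpHC a 1 1 k) y (B1 y) (by simp)
      (by push_cast; exact h1)
    have := (h1.sub e1).sub (h0.mul_left a)
    have h4 : HasSum (fun _ : ℕ => (0 : ℂ)) _ := kp_hasSum_congr this fun k => by
      have := kp_binom_rec a k
      linear_combination (y ^ k) * this
    have h5 := h4.unique hasSum_zero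
    change B1 y - y * B1 y - a * B0 y = 0 at h5
    linear_combination h5
  have hn : ∀ x : ℝ, x ∈ Ico (0 : ℝ) 1 → ‖(x : ℂ)‖ < 1 := by
    intro x hx
    rw [Complex.norm_real, Real.norm_of_nonneg hx.1]; exact hx.2
  have h1x : ∀ x : ℝ, x ∈ Ico (0 : ℝ) 1 → (1 - (x : ℂ)) ≠ 0 := by
    intro x hx h
    have := congrArg Complex.re h
    simp at this
    linarith [hx.2]
  have dh : ∀ x : ℝ, x ∈ Ico (0 : ℝ) 1 →
      HasDerivAt (fun z : ℂ => B0 z * (1 - z) ^ a) 0 x := by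
    intro x hx
    have := (d0 x (hn x hx)).mul (((hasDerivAt_id (x : ℂ)).const_sub 1).cpow_const (c := a) (by
      left; simpa using hx.2))
    refine this.congr_deriv ?_
    have h1 := h1x x hx
    simp only [id]
    rw [Complex.cpow_sub _ _ h1, Complex.cpow_one]
    have := hode x (hn x hx)
    field_simp
    linear_combination (1 - (x : ℂ)) ^ a * this
  have hI : (0 : ℝ) ∈ Ico (0 : ℝ) 1 := by simp
  have hconst := kp_const_of_deriv (fun x : ℝ => B0 x * (1 - (x : ℂ)) ^ a)
    (dh 0 hI).comp_ofReal.continuousAt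
    (fun x hx => (dh x (Ioo_subset_Ico_self hx)).comp_ofReal) X hX
  have hX' := Ioo_subset_Ico_self hX
  convert (kp_summable_ps _ _ hb0 X (hn X hX')).hasSum using 1
  change _ = B0 X
  have : B0 0 = 1 := by
    simp only [hB0]
    rw [tsum_eq_single 0 (by intro k hk; simp [hk])]
    simp [kpHC]
  have h1 := h1x X hX'
  have hc : (1 - (X : ℂ)) ^ a ≠ 0 := by
    rw [Ne, Complex.cpow_eq_zero_iff]; tauto
  simp [this] at hconst
  push_cast
  rw [Complex.cpow_neg]
  field_simp
  linear_combination -hconst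

open PowerSeries in
lemma kp_hc_ode (a b c : ℂ) :
    letI f := PowerSeries.mk (kpHC a b c)
    X * (1 - X) * (d⁄dX ℂ) ((d⁄dX ℂ) f) + (C c - C (a + b + 1) * X) * (d⁄dX ℂ) f
      - C (a * b) * f = 0 := by
  ext n
  have h := kpHC_rec a b c n
  generalize hA : a + b + 1 = A
  generalize hB : a * b = B
  rw [show (X : PowerSeries ℂ) * (1 - X) * (d⁄dX ℂ) ((d⁄dX ℂ) (PowerSeries.mk (kpHC a b c)))
    + (C c - C A * X) * (d⁄dX ℂ) (PowerSeries.mk (kpHC a b c))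
      - C B * (PowerSeries.mk (kpHC a b c)) =
     X * (d⁄dX ℂ) ((d⁄dX ℂ) (PowerSeries.mk (kpHC a b c)))
     - X * (X * (d⁄dX ℂ) ((d⁄dX ℂ) (PowerSeries.mk (kpHC a b c))))
     + C c * (d⁄dX ℂ) (PowerSeries.mk (kpHC a b c))
     - C A * (X * (d⁄dX ℂ) (PowerSeries.mk (kpHC a b c)))
      - C B * (PowerSeries.mk (kpHC a b c)) by ring]
  simp only [map_sub, map_add, coeff_C_mul, map_zero]
  rcases n with _ | _ | n
  · simp [coeff_derivative] at h ⊢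
    subst hA hB
    linear_combination h
  · simp [coeff_succ_X_mul, coeff_derivative] at h ⊢
    subst hA hB
    linear_combination h
  · simp [coeff_succ_X_mul, coeff_derivative] at h ⊢
    subst hA hB
    linear_combination h

open PowerSeries in
lemma kp_ode_unique (a b c : ℂ) (hc : ∀ n : ℕ, c + n ≠ 0) (H : PowerSeries ℂ)
    (hH : X * (1 - X) * (d⁄dX ℂ) ((d⁄dX ℂ) H) + (C c - C (a + b + 1) * X) * (d⁄dX ℂ) H
      - C (a * b) * H = 0) (h0 : coeff 0 H = kpHC a b c 0) :
    ∀ n, coeff n H = kpHC a b c n := by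
  intro n
  generalize hA : a + b + 1 = A at hH
  generalize hB : a * b = B at hH
  induction n with
  | zero => exact h0
  | succ n ih =>
    have h := kpHC_rec a b c n
    have hn : (n : ℂ) + 1 ≠ 0 := by exact_mod_cast Nat.succ_ne_zero n
    refine mul_left_cancel₀ (mul_ne_zero hn (hc n)) ?_
    rw [h, ← ih]
    have h1 : coeff n (X * (d⁄dX ℂ) ((d⁄dX ℂ) H)
     - X * (X * (d⁄dX ℂ) ((d⁄dX ℂ) H))
     + C c * (d⁄dX ℂ) H
     - C A * (X * (d⁄dX ℂ) H)
      - C B * H) = 0 := by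
      rw [← map_zero (coeff n), ← hH]; congr 1; ring
    simp only [map_sub, map_add, coeff_C_mul] at h1
    rcases n with _ | _ | n
    · simp [coeff_derivative] at h1 ⊢
      subst hA hB
      linear_combination h1
    · simp [coeff_succ_X_mul, coeff_derivative] at h1 ⊢
      subst hA hB
      linear_combination h1
    · simp [coeff_succ_X_mul, coeff_derivative] at h1 ⊢
      subst hA hB
      linear_combination h1

open PowerSeries in
lemma kp_euler_coeff (a b c : ℂ) (hc : ∀ n : ℕ, c + n ≠ 0) (n : ℕ) :
    ∑ p ∈ Finset.HasAntidiagonal.antidiagonal n, kpHC (c - a - b) 1 1 p.1 * kpHC a b c p.2 =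
      kpHC (c - a) (c - b) c n := by
  set E : PowerSeries ℂ := PowerSeries.mk (kpHC (c - a - b) 1 1) with hE
  set F : PowerSeries ℂ := PowerSeries.mk (kpHC a b c) with hF
  have hode := kp_hc_ode a b c
  have hE1 : (1 - X) * (d⁄dX ℂ) E = C (c - a - b) * E := by
    rw [sub_mul, one_mul, hE]
    generalize c - a - b = A
    ext n
    have h := kp_binom_rec A n
    rw [map_sub, coeff_C_mul]
    rcases n with _ | n
    · rw [coeff_derivative]
      simp at h ⊢
      linear_combination h
    · simp [coeff_succ_X_mul, coeff_derivative] at h ⊢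
      linear_combination h
  have hE2 : (1 - X) * (d⁄dX ℂ) ((d⁄dX ℂ) E) = (C (c - a - b) + 1) * (d⁄dX ℂ) E := by
    have := congrArg (d⁄dX ℂ) hE1
    generalize c - a - b = A at this ⊢
    simp only [Derivation.leibniz, smul_eq_mul, map_sub, derivative_C, derivative_X] at this
    rw [show (d⁄dX ℂ) (1 : PowerSeries ℂ) = 0 from Derivation.map_one_eq_zero _] at this
    linear_combination this
  have key := kp_ode_unique (c - a) (c - b) c hc (E * F) ?_ ?_ n
  · rw [← key, coeff_mul]
    simp [hE, hF]
  · have h1 : (1 - X : PowerSeries ℂ) ≠ 0 := by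
      intro h
      have := congrArg (coeff 0) h
      simp at this
    refine mul_left_cancel₀ h1 ?_
    simp only [Derivation.leibniz, smul_eq_mul, map_add]
    simp only [map_sub, map_add, map_mul, map_one] at hE1 hE2 hode ⊢
    change X * (1 - X) * (d⁄dX ℂ) ((d⁄dX ℂ) F) + (C c - (C a + C b + 1) * X) * (d⁄dX ℂ) F
      - C a * C b * F = 0 at hode
    generalize (d⁄dX ℂ) ((d⁄dX ℂ) F) = F2 at *
    generalize (d⁄dX ℂ) F = F1 at *
    generalize (d⁄dX ℂ) ((d⁄dX ℂ) E) = E2 at *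
    generalize (d⁄dX ℂ) E = E1 at *
    generalize (C a : PowerSeries ℂ) = A at *
    generalize (C b : PowerSeries ℂ) = B at *
    generalize (C c : PowerSeries ℂ) = D at *
    linear_combination ((1 - X) * E) * hode + (X * (1 - X) * F) * hE2 +
      (2 * X * (1 - X) * F1 + F * (D - (2 * D - A - B + 1) * X) + X * F * (D - A - B + 1)) * hE1
  · simp [coeff_mul, hE, hF, kpHC]

lemma kp_euler (a b c : ℂ) (hc : ∀ n : ℕ, c + n ≠ 0) (x : ℝ) (hx : x ∈ Ioo (0 : ℝ) 1) :
    ∑' n, kpHC (c - a) (c - b) c n * (x : ℂ) ^ n =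
      ((1 - x : ℝ) : ℂ) ^ (a + b - c) * ∑' n, kpHC a b c n * (x : ℂ) ^ n := by
  have h1 := kp_binom (c - a - b) x hx
  rw [show a + b - c = -(c - a - b) by ring, ← h1.tsum_eq]
  have n1 := kpHC_summable (c - a - b) 1 1 hx.1.le hx.2
  have n2 := kpHC_summable a b c hx.1.le hx.2
  have hn : ‖(x : ℂ)‖ = x := by rw [Complex.norm_real, Real.norm_of_nonneg hx.1.le]
  rw [tsum_mul_tsum_eq_tsum_sum_antidiagonal_of_summable_norm
    (n1.congr fun k => by rw [norm_mul, norm_pow, hn])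
    (n2.congr fun k => by rw [norm_mul, norm_pow, hn])]
  refine tsum_congr fun n => ?_
  rw [← kp_euler_coeff a b c hc n, Finset.sum_mul]
  refine Finset.sum_congr rfl fun p hp => ?_
  rw [← Finset.HasAntidiagonal.mem_antidiagonal.mp hp, pow_add]
  ring

/-- Reciprocal factorial on the integers. -/
noncomputable def kpR (z : ℤ) : ℂ := if 0 ≤ z then ((z.toNat.factorial : ℕ) : ℂ)⁻¹ else 0

lemma kpR_neg {z : ℤ} (h : z < 0) : kpR z = 0 := by
  unfold kpR; rw [if_neg (by omega)]

lemma kpR_nat (n : ℕ) : kpR (n : ℤ) = ((n.factorial : ℕ) : ℂ)⁻¹ := by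
  unfold kpR; rw [if_pos (by omega)]; simp

lemma kpR_mul (z : ℤ) : kpR (z - 1) = (z : ℂ) * kpR z := by
  rcases lt_or_ge 0 z with h | h
  · obtain ⟨n, rfl⟩ : ∃ n : ℕ, z = n + 1 := ⟨(z - 1).toNat, by omega⟩
    have h1 := kpR_nat n
    have h2 := kpR_nat (n + 1)
    push_cast at h2
    rw [add_sub_cancel_right, h1, h2, Nat.factorial_succ]
    have hn : (n : ℂ) + 1 ≠ 0 := by exact_mod_cast Nat.succ_ne_zero n
    have hf : (n.factorial : ℂ) ≠ 0 := by exact_mod_cast n.factorial_ne_zero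
    push_cast
    field_simp
  · rw [kpR_neg (by omega : z - 1 < 0)]
    rcases h.lt_or_eq with h | h
    · rw [kpR_neg h]; simp
    · rw [h]; simp

/-- Coefficients in the expansion of `(xy)^n (x+y-xy)^k / k!`. -/
noncomputable def kpE (n N i j : ℤ) : ℂ :=
  (-1) ^ (i + j - n - N) * kpR (N - i) * kpR (N - j) * kpR (i + j - n - N)

lemma kpE_zero {n N i j : ℤ} (h : N < i ∨ N < j ∨ i + j < n + N) : kpE n N i j = 0 := by
  unfold kpE
  rcases h with h | h | h
  · rw [kpR_neg (by omega : N - i < 0)]; simp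
  · rw [kpR_neg (by omega : N - j < 0)]; simp
  · rw [kpR_neg (by omega : i + j - n - N < 0)]; simp

lemma kpE_step (a b c : ℂ) (n N i j : ℤ) :
    ((i : ℂ) + 1) * (i + c) * kpE n N (i + 1) j - (i + a) * (i + b) * kpE n N i j
    - ((j : ℂ) + 1) * (j + c) * kpE n N i (j + 1) + (j + a) * (j + b) * kpE n N i j =
    -(n : ℂ) * (n - 1 + c) * (kpE (n - 1) (N - 1) (i - 1) j - kpE (n - 1) (N - 1) i (j - 1))
    + (kpE n (N - 2) (i - 1) j - kpE n (N - 2) i (j - 1))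
    - ((N : ℂ) - n - c + a + b) * (kpE n (N - 1) (i - 1) j - kpE n (N - 1) i (j - 1)) := by
  obtain ⟨p, rfl⟩ : ∃ p, i = N - p := ⟨N - i, by ring⟩
  obtain ⟨q, rfl⟩ : ∃ q, j = N - q := ⟨N - j, by ring⟩
  obtain ⟨M, hM⟩ : ∃ M : ℤ, M = N - p - q - n := ⟨_, rfl⟩
  have hMn : n = N - p - q - M := by rw [hM]; ring
  subst hMn
  have hp := kpR_mul p
  have hq := kpR_mul q
  have hp2 := kpR_mul (p - 1)
  have hq2 := kpR_mul (q - 1)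
  have hm := kpR_mul (M + 1)
  have hz : (-1 : ℂ) ^ (M + 1) = -(-1) ^ M := by
    rw [zpow_add_one₀ (by norm_num)]; ring
  rw [show p - 1 - 1 = p - 2 by ring] at hp2
  rw [show q - 1 - 1 = q - 2 by ring] at hq2
  rw [show M + 1 - 1 = M by ring] at hm
  unfold kpE
  ring_nf at hp hq hp2 hq2 hm hz ⊢
  simp only [hp2, hq2, hp, hq, hm, hz]
  push_cast
  ring

/-- Weights. -/
noncomputable def kpW (a b c : ℂ) (n N : ℕ) : ℂ :=
  kpHC (c - a) (c - b) c n *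
    ((ascPochhammer ℂ N).eval a * (ascPochhammer ℂ N).eval b / Complex.Gamma (c + n + N))

lemma kpW_step (a b c : ℂ) (hc : ∀ n : ℕ, c + n ≠ 0) (n N : ℕ) :
    -((n : ℂ) + 1) * (n + c) * kpW a b c (n + 1) (N + 1) + kpW a b c n (N + 2)
    - ((N : ℂ) + 1 - n - c + a + b) * kpW a b c n (N + 1) = 0 := by
  unfold kpW
  have h := kpHC_rec (c - a) (c - b) c n
  have hn : (n : ℂ) + 1 ≠ 0 := by exact_mod_cast Nat.succ_ne_zero n
  have h' : kpHC (c - a) (c - b) c (n + 1) = (c - a + n) * (c - b + n) *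
      kpHC (c - a) (c - b) c n / ((n + 1) * (c + n)) := by
    rw [eq_div_iff (mul_ne_zero hn (hc n)), ← h]; ring
  rw [h']
  have h0 := hc n
  have h1 : c + n + N + 1 ≠ 0 := by
    have := hc (n + N + 1); push_cast at this
    convert this using 1; ring
  have hG : Complex.Gamma (c + n + N + 1) ≠ 0 := by
    refine Complex.Gamma_ne_zero fun m hm => ?_
    have := hc (n + N + 1 + m); push_cast at this
    apply this; rw [← add_assoc, ← add_assoc, ← add_assoc, hm]; ring
  rw [ascPochhammer_succ_eval (N + 1), ascPochhammer_succ_eval (N + 1)]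
  push_cast
  rw [show c + (n + 1) + (N + 1) = c + n + N + 1 + 1 by ring,
    show c + n + (N + 2 : ℂ) = c + n + N + 1 + 1 by ring, Complex.Gamma_add_one _ h1,
    show c + n + (N + 1 : ℂ) = c + n + N + 1 by ring]
  field_simp
  ring

/-- Coefficients of the product, truncated sum. -/
noncomputable def kpS (a b c : ℂ) (K : ℕ) (i j : ℤ) : ℂ :=
  ∑ n ∈ Finset.range K, ∑ N ∈ Finset.range K, kpW a b c n N * kpE n N i j

lemma kpS_indep (a b c : ℂ) (K L i j : ℕ) (h : i + j < K) (hL : K ≤ L) :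
    kpS a b c L i j = kpS a b c K i j := by
  unfold kpS
  symm
  have h1 : Finset.range K ⊆ Finset.range L := Finset.range_subset_range.mpr hL
  have : ∀ n ∈ Finset.range K, ∑ N ∈ Finset.range K, kpW a b c n N * kpE n N i j =
      ∑ N ∈ Finset.range L, kpW a b c n N * kpE n N i j := by
    intro n _
    refine Finset.sum_subset h1 fun N _ hN => ?_
    rw [kpE_zero, mul_zero]
    simp at hN; omega
  rw [Finset.sum_congr rfl this]
  refine Finset.sum_subset h1 fun n _ hn => ?_
  refine Finset.sum_eq_zero fun N _ => ?_
  rw [kpE_zero, mul_zero]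
  simp at hn; omega

lemma kpS_step (a b c : ℂ) (hc : ∀ n : ℕ, c + n ≠ 0) (i j K : ℕ) (hK : i + j < K) :
    ((i : ℂ) + 1) * (i + c) * kpS a b c (K + 2) (i + 1) j
      - (i + a) * (i + b) * kpS a b c (K + 2) i j
    - ((j : ℂ) + 1) * (j + c) * kpS a b c (K + 2) i (j + 1)
      + (j + a) * (j + b) * kpS a b c (K + 2) i j = 0 := by
  set Y : ℤ → ℤ → ℂ := fun n N => kpE n N (i - 1) j - kpE n N i (j - 1) with hY
  have hYneg : ∀ n N : ℤ, N < 0 → Y n N = 0 := by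
    intro n N hN
    simp only [hY]
    rw [kpE_zero (by omega), kpE_zero (by omega), sub_zero]
  have hYbig : ∀ n N : ℤ, 0 ≤ n → (K : ℤ) ≤ N → Y n N = 0 := by
    intro n N hn hN
    simp only [hY]
    rw [kpE_zero (by omega), kpE_zero (by omega), sub_zero]
  have hYbig' : ∀ n N : ℤ, 0 ≤ N → (K : ℤ) ≤ n → Y n N = 0 := by
    intro n N hn hN
    simp only [hY]
    rw [kpE_zero (by omega), kpE_zero (by omega), sub_zero]
  have e1 : ((i : ℂ) + 1) * (i + c) * kpS a b c (K + 2) (i + 1) j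
      - (i + a) * (i + b) * kpS a b c (K + 2) i j
    - ((j : ℂ) + 1) * (j + c) * kpS a b c (K + 2) i (j + 1)
      + (j + a) * (j + b) * kpS a b c (K + 2) i j =
      ∑ n ∈ Finset.range (K + 2), ∑ N ∈ Finset.range (K + 2), kpW a b c n N *
       (-(n : ℂ) * (n - 1 + c) * Y (n - 1) (N - 1) + Y n (N - 2)
        - ((N : ℂ) - n - c + a + b) * Y n (N - 1)) := by
    unfold kpS
    simp only [Finset.mul_sum, ← Finset.sum_sub_distrib, ← Finset.sum_add_distrib]
    refine Finset.sum_congr rfl fun n _ => Finset.sum_congr rfl fun N _ => ?_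
    have := kpE_step a b c n N i j
    simp only [hY]
    push_cast at this
    linear_combination (kpW a b c n N) * this
  rw [e1]
  simp only [mul_add, mul_sub, Finset.sum_add_distrib, Finset.sum_sub_distrib]
  have s1 : ∑ n ∈ Finset.range (K + 2), ∑ N ∈ Finset.range (K + 2), kpW a b c n N *
      (-(n : ℂ) * (n - 1 + c) * Y (n - 1) (N - 1)) =
      ∑ n ∈ Finset.range K, ∑ N ∈ Finset.range K, kpW a b c (n + 1) (N + 1) *
      (-((n : ℂ) + 1) * (n + c) * Y n N) := by
    rw [Finset.sum_range_succ', Finset.sum_range_succ]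
    rw [show (∑ N ∈ Finset.range (K + 2), kpW a b c (K + 1) N *
      (-((K + 1 : ℕ) : ℂ) * (((K + 1 : ℕ) : ℂ) - 1 + c) * Y (((K + 1 : ℕ) : ℤ) - 1) (N - 1))) = 0 from
        Finset.sum_eq_zero fun N _ => by
          rcases Nat.eq_zero_or_pos N with h | h
          · rw [hYneg _ _ (by omega)]; simp
          · rw [hYbig' _ _ (by omega) (by omega)]; simp]
    rw [show (∑ N ∈ Finset.range (K + 2), kpW a b c 0 N *
      (-((0 : ℕ) : ℂ) * (((0 : ℕ) : ℂ) - 1 + c) * Y (((0 : ℕ) : ℤ) - 1) (N - 1))) = 0 from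
        Finset.sum_eq_zero fun N _ => by simp]
    rw [add_zero, add_zero]
    refine Finset.sum_congr rfl fun n _ => ?_
    rw [Finset.sum_range_succ', Finset.sum_range_succ]
    rw [hYbig _ _ (by omega) (by omega), hYneg _ _ (by omega)]
    simp
  have hcut : ∀ g : ℕ → ℕ → ℂ, (∀ n N, K ≤ n → g n N = 0) →
      ∑ n ∈ Finset.range (K + 2), ∑ N ∈ Finset.range K, g n N =
        ∑ n ∈ Finset.range K, ∑ N ∈ Finset.range K, g n N := by
    intro g hg
    symm
    refine Finset.sum_subset (Finset.range_subset_range.mpr (by omega)) fun n _ hn => ?_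
    refine Finset.sum_eq_zero fun N _ => hg n N ?_
    simpa using hn
  have s2 : ∑ n ∈ Finset.range (K + 2), ∑ N ∈ Finset.range (K + 2), kpW a b c n N * Y n (N - 2) =
      ∑ n ∈ Finset.range K, ∑ N ∈ Finset.range K, kpW a b c n (N + 2) * Y n N := by
    have : ∀ n : ℕ, ∑ N ∈ Finset.range (K + 2), kpW a b c n N * Y n (N - 2) =
        ∑ N ∈ Finset.range K, kpW a b c n (N + 2) * Y n N := by
      intro n
      rw [Finset.sum_range_succ', Finset.sum_range_succ',
        hYneg _ _ (by omega), hYneg _ _ (by omega)]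
      simp only [mul_zero, add_zero]
      refine Finset.sum_congr rfl fun N _ => ?_
      congr 2
      push_cast; ring
    simp only [this]
    refine hcut _ fun n N hn => ?_
    rw [hYbig' _ _ (by omega) (by omega), mul_zero]
  have s3 : ∑ n ∈ Finset.range (K + 2), ∑ N ∈ Finset.range (K + 2), kpW a b c n N *
        (((N : ℂ) - n - c + a + b) * Y n (N - 1)) =
      ∑ n ∈ Finset.range K, ∑ N ∈ Finset.range K, kpW a b c n (N + 1) *
        (((N : ℂ) + 1 - n - c + a + b) * Y n N) := by
    have : ∀ n : ℕ, ∑ N ∈ Finset.range (K + 2), kpW a b c n N *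
        (((N : ℂ) - n - c + a + b) * Y n (N - 1)) =
        ∑ N ∈ Finset.range K, kpW a b c n (N + 1) *
        (((N : ℂ) + 1 - n - c + a + b) * Y n N) := by
      intro n
      rw [Finset.sum_range_succ', Finset.sum_range_succ,
        hYneg n (((0 : ℕ) : ℤ) - 1) (by omega), hYbig n (((K + 1 : ℕ) : ℤ) - 1) (by omega) (by omega)]
      simp
    simp only [this]
    refine hcut _ fun n N hn => ?_
    rw [hYbig' _ _ (by omega) (by omega), mul_zero, mul_zero]
  have hsplit : ∑ n ∈ Finset.range K, ∑ N ∈ Finset.range K, (kpW a b c (n + 1) (N + 1) *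
      (-((n : ℂ) + 1) * (n + c) * Y n N) + kpW a b c n (N + 2) * Y n N -
      kpW a b c n (N + 1) * (((N : ℂ) + 1 - n - c + a + b) * Y n N)) = 0 := by
    refine Finset.sum_eq_zero fun n _ => Finset.sum_eq_zero fun N _ => ?_
    linear_combination (Y n N) * kpW_step a b c hc n N
  simp only [Finset.sum_add_distrib, Finset.sum_sub_distrib] at hsplit
  rw [← s1, ← s2, ← s3] at hsplit
  rw [← hsplit]
  simp only [mul_add, mul_sub, add_mul, sub_mul, Finset.sum_add_distrib, Finset.sum_sub_distrib]

lemma kpS_eq (a b c : ℂ) (hc : ∀ n : ℕ, c + n ≠ 0) (j : ℕ) : ∀ i K : ℕ, i + j < K →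
    kpS a b c K i j = kpHC a b c i * kpHC a b c j := by
  induction j with
  | zero =>
    intro i K hK
    rw [kpS_indep a b c (i + 1) K i 0 (by omega) (by omega)]
    unfold kpS
    rw [Finset.sum_eq_single 0, Finset.sum_eq_single i]
    · have h1 := kpR_nat i
      have h0 := kpR_nat 0
      simp at h0
      simp [kpE, kpW, h1, h0, kpHC]
      field_simp
    · intro N _ hN
      rw [kpE_zero (by omega), mul_zero]
    · simp
    · intro n _ hn
      refine Finset.sum_eq_zero fun N _ => ?_
      rw [kpE_zero (by omega), mul_zero]
    · simp
  | succ j ih =>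
    intro i K hK
    rw [← kpS_indep a b c K (K + 2) i (j + 1) (by omega) (by omega)]
    have h := kpS_step a b c hc i j K (by omega)
    have i1 := ih i (K + 2) (by omega)
    have i2 := ih (i + 1) (K + 2) (by omega)
    push_cast at i2 ⊢
    rw [i1, i2] at h
    have r1 := kpHC_rec a b c i
    have r2 := kpHC_rec a b c j
    have hn : (j : ℂ) + 1 ≠ 0 := by exact_mod_cast Nat.succ_ne_zero j
    refine mul_left_cancel₀ (mul_ne_zero hn (hc j)) ?_
    linear_combination -h + kpHC a b c j * r1 - kpHC a b c i * r2

lemma kpE_val (n k l m r d : ℕ) (hl : l ≤ k) (hm : m = n + l) (hd : n + k = d + l) :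
    (k.factorial : ℂ) * kpE n (n + k : ℕ) (r + d : ℕ) m =
      (-1) ^ r * ((k.choose l : ℕ) : ℂ) * ((l.choose r : ℕ) : ℂ) := by
  rcases le_or_gt r l with h | h
  · unfold kpE
    rw [show ((n + k : ℕ) : ℤ) - (r + d : ℕ) = ((l - r : ℕ) : ℤ) by omega,
      show ((n + k : ℕ) : ℤ) - m = ((k - l : ℕ) : ℤ) by omega,
      show ((r + d : ℕ) : ℤ) + m - n - (n + k : ℕ) = (r : ℕ) by omega,
      kpR_nat, kpR_nat, kpR_nat, Nat.cast_choose ℂ hl, Nat.cast_choose ℂ h, zpow_natCast]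
    have h1 : (k.factorial : ℂ) ≠ 0 := by exact_mod_cast k.factorial_ne_zero
    have h2 : (l.factorial : ℂ) ≠ 0 := by exact_mod_cast l.factorial_ne_zero
    have h3 : (r.factorial : ℂ) ≠ 0 := by exact_mod_cast r.factorial_ne_zero
    have h4 : ((k - l).factorial : ℂ) ≠ 0 := by exact_mod_cast (k - l).factorial_ne_zero
    have h5 : ((l - r).factorial : ℂ) ≠ 0 := by exact_mod_cast (l - r).factorial_ne_zero
    field_simp
  · rw [Nat.choose_eq_zero_of_lt h, kpE_zero (by omega)]; simp

lemma kp_binsum {𝕜 : Type*} [RCLike 𝕜] (x σ C : 𝕜) (d l : ℕ) (g : ℕ → 𝕜) (h0 : ∀ i < d, g i = 0)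
    (h1 : ∀ r, g (r + d) = σ ^ r * C * ((l.choose r : ℕ) : 𝕜)) :
    HasSum (fun i => g i * x ^ i) (C * x ^ d * (1 + σ * x) ^ l) := by
  have := (hasSum_nat_add_iff (f := fun i => g i * x ^ i) d
    (g := C * x ^ d * (1 + σ * x) ^ l)).mp ?_
  · rwa [Finset.sum_eq_zero (fun i hi => by rw [h0 i (by simpa using hi), zero_mul]),
      add_zero] at this
  · have : C * x ^ d * (1 + σ * x) ^ l =
        ∑ r ∈ Finset.range (l + 1), g (r + d) * x ^ (r + d) := by
      rw [add_comm 1, add_pow, Finset.mul_sum]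
      refine Finset.sum_congr rfl fun r _ => ?_
      rw [h1]; ring
    rw [this]
    refine hasSum_sum_of_ne_finset_zero fun r hr => ?_
    rw [h1, Nat.choose_eq_zero_of_lt (by simpa using hr)]
    simp

/-- The coefficient of `y ^ m` in `(x y)^n (x + y - x y)^k`. -/
noncomputable def kpY (x : ℝ) (n k m : ℕ) : ℝ :=
  if n ≤ m then ((k.choose (m - n) : ℕ) : ℝ) * x ^ (n + k - (m - n)) * (1 - x) ^ (m - n) else 0

lemma kpY_nonneg {x : ℝ} (hx : x ∈ Ioo (0 : ℝ) 1) (n k m : ℕ) : 0 ≤ kpY x n k m := by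
  unfold kpY
  have := hx.1
  have := sub_pos.mpr hx.2
  split_ifs <;> positivity

lemma kp_beta_sum (x y : ℝ) (n k : ℕ) :
    HasSum (fun m => kpY x n k m * y ^ m) ((x * y) ^ n * (x + y - x * y) ^ k) := by
  have := (hasSum_nat_add_iff (f := fun m => kpY x n k m * y ^ m) n
    (g := (x * y) ^ n * (x + y - x * y) ^ k)).mp ?_
  · rwa [Finset.sum_eq_zero (fun i hi => by
      have : ¬ n ≤ i := by simpa using hi
      rw [kpY, if_neg this, zero_mul]), add_zero] at this
  · have : (x * y) ^ n * (x + y - x * y) ^ k =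
        ∑ l ∈ Finset.range (k + 1), kpY x n k (l + n) * y ^ (l + n) := by
      rw [show x + y - x * y = (1 - x) * y + x by ring, add_pow, Finset.mul_sum]
      refine Finset.sum_congr rfl fun l hl => ?_
      have hl' : l ≤ k := by simp at hl; omega
      rw [kpY, if_pos (by omega), Nat.add_sub_cancel, Nat.add_sub_assoc hl', pow_add, pow_add,
        mul_pow, mul_pow]
      ring
    rw [this]
    refine hasSum_sum_of_ne_finset_zero fun l hl => ?_
    have hl' : k < l := by simp at hl; omega
    rw [kpY, if_pos (by omega), Nat.add_sub_cancel, Nat.choose_eq_zero_of_lt hl']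
    simp

lemma kp_alpha_sum {x : ℝ} (hx : x ∈ Ioo (0 : ℝ) 1) (n k m : ℕ) :
    HasSum (fun i : ℕ => (k.factorial : ℂ) * kpE n (n + k : ℕ) i m * (x : ℂ) ^ i)
      ((kpY x n k m : ℝ) : ℂ) ∧
    Summable (fun i : ℕ => ‖(k.factorial : ℂ) * kpE n (n + k : ℕ) i m * (x : ℂ) ^ i‖) ∧
    ∑' i : ℕ, ‖(k.factorial : ℂ) * kpE n (n + k : ℕ) i m * (x : ℂ) ^ i‖ ≤
      kpY x n k m * ((1 + x) / (1 - x)) ^ m := by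
  have hn : ‖(x : ℂ)‖ = x := by rw [Complex.norm_real, Real.norm_of_nonneg hx.1.le]
  have hx0 := hx.1
  have h1x := sub_pos.mpr hx.2
  by_cases h : n ≤ m ∧ m - n ≤ k
  · obtain ⟨l, rfl⟩ : ∃ l, m = n + l := ⟨m - n, by omega⟩
    have hl : l ≤ k := by omega
    obtain ⟨d, hd⟩ : ∃ d, n + k = d + l := ⟨n + k - l, by omega⟩
    have hz : ∀ i < d, kpE n (n + k : ℕ) i (n + l : ℕ) = 0 := fun i hi => kpE_zero (by omega)
    have hv : ∀ r, _ := fun r => kpE_val n k l (n + l) r d hl rfl hd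
    have hY : kpY x n k (n + l) = (k.choose l : ℝ) * x ^ d * (1 - x) ^ l := by
      rw [kpY, if_pos (by omega), show n + l - n = l by omega, show n + k - l = d by omega]
    have s2 := kp_binsum x 1 (k.choose l) d l
      (fun i => ‖(k.factorial : ℂ) * kpE n (n + k : ℕ) i (n + l : ℕ)‖)
      (fun i hi => by simp only [hz i hi]; simp) (fun r => by simp only [hv]; simp)
    have s1 := kp_binsum (x : ℂ) (-1) (k.choose l) d l
      (fun i => ((k.factorial : ℂ) * kpE n (n + k : ℕ) i (n + l : ℕ)))
      (fun i hi => by simp only [hz i hi]; simp) hv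
    have s2' := s2.congr_fun (g := fun i : ℕ => ‖(k.factorial : ℂ) *
        kpE n (n + k : ℕ) i (n + l : ℕ) * (x : ℂ) ^ i‖)
        (fun i => by rw [norm_mul _ ((x : ℂ) ^ i), norm_pow, hn])
    refine ⟨?_, s2'.summable, ?_⟩
    · rw [hY]
      have e0 : ((((k.choose l : ℝ) * x ^ d * (1 - x) ^ l : ℝ)) : ℂ) =
          (k.choose l : ℂ) * (x : ℂ) ^ d * (1 + -1 * (x : ℂ)) ^ l := by
        push_cast
        rw [show (1 : ℂ) + -1 * (x : ℂ) = 1 - x by ring]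
      rw [e0]
      exact s1
    · rw [s2'.tsum_eq, hY]
      have e : (1 - x) ^ l * ((1 + x) / (1 - x)) ^ l = (1 + x) ^ l := by
        rw [div_pow]; field_simp
      have h2 : ((1 + x) / (1 - x)) ^ l ≤ ((1 + x) / (1 - x)) ^ (n + l) := by
        refine pow_le_pow_right₀ ?_ (by omega)
        rw [le_div_iff₀ h1x]; linarith
      calc (k.choose l : ℝ) * x ^ d * (1 + 1 * x) ^ l
          = (k.choose l : ℝ) * x ^ d * (1 - x) ^ l * ((1 + x) / (1 - x)) ^ l := by
            rw [mul_assoc _ ((1 - x) ^ l), e, one_mul]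
        _ ≤ _ := by gcongr
  · have hz : ∀ i : ℕ, kpE n (n + k : ℕ) i m = 0 := fun i => kpE_zero (by omega)
    have hY : kpY x n k m = 0 := by
      unfold kpY
      split_ifs with h'
      · rw [Nat.choose_eq_zero_of_lt (by omega)]; simp
      · rfl
    simp only [hz, hY]
    simp

lemma kpS_tsum (a b c : ℂ) (i m : ℕ) :
    HasSum (fun p : ℕ × ℕ => kpW a b c p.1 (p.1 + p.2) * kpE p.1 (p.1 + p.2 : ℕ) i m)
      (kpS a b c (i + m + 1) i m) := by
  have : kpS a b c (i + m + 1) i m = ∑ p ∈ Finset.range (i + m + 1) ×ˢ Finset.range (i + m + 1),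
      kpW a b c p.1 (p.1 + p.2) * kpE p.1 (p.1 + p.2 : ℕ) i m := by
    unfold kpS
    rw [Finset.sum_product]
    refine Finset.sum_congr rfl fun n _ => ?_
    have h := Finset.sum_Ico_eq_sum_range
      (fun N : ℕ => kpW a b c n N * kpE n N i m) n (n + (i + m + 1))
    rw [show n + (i + m + 1) - n = i + m + 1 by omega] at h
    rw [← h]
    have h1 : ∑ N ∈ Finset.range (i + m + 1), kpW a b c n N * kpE n N i m =
        ∑ N ∈ Finset.range (n + (i + m + 1)), kpW a b c n N * kpE n N i m := by
      refine Finset.sum_subset (Finset.range_subset_range.mpr (by omega)) fun N _ hN => ?_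
      rw [kpE_zero, mul_zero]
      simp at hN; omega
    rw [h1]
    symm
    refine Finset.sum_subset (fun N hN => by simp at hN ⊢; omega) fun N _ hN => ?_
    rw [kpE_zero, mul_zero]
    simp at hN; omega
  rw [this]
  refine hasSum_sum_of_ne_finset_zero fun p hp => ?_
  rw [kpE_zero, mul_zero]
  simp at hp; omega

/-- Burchnall and Chaundy type expansion. -/
lemma kp_BC (a b c : ℂ) (hc : ∀ n : ℕ, c + n ≠ 0) {x y : ℝ} (hx : x ∈ Ioo (0 : ℝ) 1)
    (hy : y ∈ Ioo (0 : ℝ) 1)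
    (hs : Summable fun p : ℕ × ℕ => ‖kpW a b c p.1 (p.1 + p.2) / (p.2.factorial : ℂ)‖ *
      ((x * y) ^ p.1 * (x + y - x * y) ^ p.2)) :
    ∑' p : ℕ × ℕ, kpW a b c p.1 (p.1 + p.2) / (p.2.factorial : ℂ) *
      (((x * y) ^ p.1 * (x + y - x * y) ^ p.2 : ℝ) : ℂ) =
    (∑' i, kpHC a b c i * (x : ℂ) ^ i) * ∑' j, kpHC a b c j * (y : ℂ) ^ j := by
  obtain ⟨A, hA⟩ : ∃ A : ℕ × ℕ → ℂ,
      ∀ p, kpW a b c p.1 (p.1 + p.2) / (p.2.factorial : ℂ) = A p := ⟨_, fun p => rfl⟩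
  simp only [hA] at hs ⊢
  have hx0 := hx.1
  have hy0 := hy.1
  have h1x := sub_pos.mpr hx.2
  have hnx : ‖(x : ℂ)‖ = x := by rw [Complex.norm_real, Real.norm_of_nonneg hx.1.le]
  have hny : ‖(y : ℂ)‖ = y := by rw [Complex.norm_real, Real.norm_of_nonneg hy.1.le]
  have hS1 : Summable fun q : (ℕ × ℕ) × ℕ => ‖A q.1‖ * (kpY x q.1.1 q.1.2 q.2 * y ^ q.2) := by
    rw [summable_prod_of_nonneg (fun q => mul_nonneg (norm_nonneg _)
      (mul_nonneg (kpY_nonneg hx _ _ _) (by positivity)))]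
    refine ⟨fun p => ?_, ?_⟩
    · have h0 := (kp_beta_sum x y p.1 p.2).summable.mul_left ‖A p‖
      exact h0
    refine hs.congr fun p => ?_
    simp only
    rw [tsum_mul_left, (kp_beta_sum x y p.1 p.2).tsum_eq]
  have hS1c : Summable fun q : (ℕ × ℕ) × ℕ =>
      A q.1 * ((kpY x q.1.1 q.1.2 q.2 * y ^ q.2 : ℝ) : ℂ) := by
    refine Summable.of_norm (hS1.congr fun q => ?_)
    rw [norm_mul, Complex.norm_real, Real.norm_of_nonneg (mul_nonneg (kpY_nonneg hx _ _ _)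
      (by positivity))]
  have e1 : ∀ p : ℕ × ℕ, A p * (((x * y) ^ p.1 * (x + y - x * y) ^ p.2 : ℝ) : ℂ) =
      ∑' m, A p * ((kpY x p.1 p.2 m * y ^ m : ℝ) : ℂ) := by
    intro p
    rw [tsum_mul_left, ← Complex.ofReal_tsum, (kp_beta_sum x y p.1 p.2).tsum_eq]
  simp only [e1]
  rw [← Summable.tsum_comm (f := fun (p : ℕ × ℕ) (m : ℕ) =>
    A p * ((kpY x p.1 p.2 m * y ^ m : ℝ) : ℂ)) hS1c]
  have hT : ∀ m : ℕ, ∑' p : ℕ × ℕ, A p * ((kpY x p.1 p.2 m * y ^ m : ℝ) : ℂ) =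
      (∑' i, kpHC a b c i * (x : ℂ) ^ i) * (kpHC a b c m * (y : ℂ) ^ m) := by
    intro m
    have hSm : Summable fun p : ℕ × ℕ => ‖A p‖ * kpY x p.1 p.2 m := by
      have h1 := ((Equiv.prodComm ℕ (ℕ × ℕ)).summable_iff.mpr hS1).prod_factor m
      have h2 := h1.mul_right (y ^ m)⁻¹
      refine h2.congr fun p => ?_
      have : y ^ m ≠ 0 := by positivity
      simp
      field_simp
    have hS2 : Summable fun q : (ℕ × ℕ) × ℕ => ‖A q.1 *
        ((q.1.2.factorial : ℂ) * kpE q.1.1 (q.1.1 + q.1.2 : ℕ) q.2 m * (x : ℂ) ^ q.2)‖ := by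
      rw [summable_prod_of_nonneg (fun q => norm_nonneg _)]
      refine ⟨fun p => ?_, ?_⟩
      · simp only [norm_mul (A p)]
        exact ((kp_alpha_sum hx p.1 p.2 m).2.1).mul_left _
      · refine Summable.of_nonneg_of_le (fun p => tsum_nonneg fun i => norm_nonneg _) (fun p => ?_)
          (hSm.mul_right (((1 + x) / (1 - x)) ^ m))
        simp only [norm_mul (A p)]
        rw [tsum_mul_left, mul_assoc]
        exact mul_le_mul_of_nonneg_left (kp_alpha_sum hx p.1 p.2 m).2.2 (norm_nonneg _)
    have e2 : ∀ p : ℕ × ℕ, A p * ((kpY x p.1 p.2 m * y ^ m : ℝ) : ℂ) = (∑' i : ℕ, A p *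
        ((p.2.factorial : ℂ) * kpE p.1 (p.1 + p.2 : ℕ) i m * (x : ℂ) ^ i)) * (y : ℂ) ^ m := by
      intro p
      rw [tsum_mul_left, (kp_alpha_sum hx p.1 p.2 m).1.tsum_eq]
      push_cast; ring
    simp only [e2]
    rw [tsum_mul_right, ← Summable.tsum_comm (f := fun (p : ℕ × ℕ) (i : ℕ) => A p *
        ((p.2.factorial : ℂ) * kpE p.1 (p.1 + p.2 : ℕ) i m * (x : ℂ) ^ i)) hS2.of_norm,
      ← mul_assoc, ← tsum_mul_right (a := kpHC a b c m)]
    refine congrArg (· * (y : ℂ) ^ m) (tsum_congr fun i => ?_)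
    have h3 := (kpS_tsum a b c i m).mul_right ((x : ℂ) ^ i)
    rw [kpS_eq a b c hc m i _ (by omega)] at h3
    rw [show kpHC a b c i * (x : ℂ) ^ i * kpHC a b c m =
      kpHC a b c i * kpHC a b c m * (x : ℂ) ^ i by ring, ← h3.tsum_eq]
    refine tsum_congr fun p => ?_
    have hf : (p.2.factorial : ℂ) ≠ 0 := by exact_mod_cast p.2.factorial_ne_zero
    rw [← hA]
    field_simp
  simp only [hT]
  rw [tsum_mul_left]

lemma kp_asc_norm_le (s : ℂ) (N : ℕ) (h : ‖s‖ ≤ N) (k : ℕ) :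
    ‖(ascPochhammer ℂ k).eval s‖ ≤ (N.ascFactorial k : ℝ) := by
  induction k with
  | zero => simp
  | succ k ih =>
    rw [ascPochhammer_succ_eval, norm_mul, Nat.ascFactorial_succ]
    push_cast
    rw [mul_comm]
    have : ‖s + k‖ ≤ (N : ℝ) + k := by
      refine (norm_add_le _ _).trans ?_
      rw [Complex.norm_natCast]; linarith
    gcongr

lemma kpCat_norm_le (s : ℂ) (M : ℕ) (h : ‖s + 1‖ ≤ M) (n k : ℕ) :
    ‖kpCat (s + 2 * n) k‖ ≤ 2 ^ M * (4 ^ n * 4 ^ k : ℝ) := by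
  have h1 : ‖s + 2 * n + k + 1‖ ≤ ((M + 2 * n + k : ℕ) : ℝ) := by
    have e : s + 2 * n + k + 1 = (s + 1) + ((2 * n + k : ℕ) : ℂ) := by push_cast; ring
    rw [e]
    refine (norm_add_le _ _).trans ?_
    rw [Complex.norm_natCast]; push_cast; linarith
  have h2 := kp_asc_norm_le _ _ h1 k
  rw [Nat.ascFactorial_eq_factorial_mul_choose'] at h2
  have hf : (0 : ℝ) < k.factorial := by exact_mod_cast k.factorial_pos
  unfold kpCat
  rw [norm_div, Complex.norm_natCast, div_le_iff₀ hf]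
  refine h2.trans ?_
  have h3 : ((M + 2 * n + k + k - 1).choose k : ℝ) ≤ 2 ^ (M + 2 * n + k + k) := by
    have h4 := Nat.choose_le_two_pow (M + 2 * n + k + k - 1) k
    have h5 : 2 ^ (M + 2 * n + k + k - 1) ≤ 2 ^ (M + 2 * n + k + k) :=
      Nat.pow_le_pow_right (by norm_num) (by omega)
    exact_mod_cast h4.trans h5
  push_cast
  rw [mul_comm]
  have e : (2 : ℝ) ^ (M + 2 * n + k + k) = 2 ^ M * (4 ^ n * 4 ^ k) := by
    rw [show (4 : ℝ) = 2 ^ 2 by norm_num, ← pow_mul, ← pow_mul, ← pow_add, ← pow_add]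
    congr 1; ring
  rw [← e]
  gcongr

/-- The coefficients of the double expansion. -/
noncomputable def kpD (lam α : ℂ) (x y : ℝ) (p : ℕ × ℕ) : ℂ :=
  kpHC (lam / 2 + α + 1 / 2) (lam / 2 + α) (lam + α + 1) p.1 * ((x * y / 4 : ℝ) : ℂ) ^ p.1 *
    ((x + y - x * y) / 4 : ℝ) ^ p.2 * kpCat (lam + α + 2 * p.1) p.2

lemma kpD_summable (lam α : ℂ) {x y : ℝ} (hx : x ∈ Ioo (0 : ℝ) 1) (hy : y ∈ Ioo (0 : ℝ) 1) :
    ∃ r : ℝ, 1 < r ∧ Summable fun p : ℕ × ℕ => ‖kpD lam α x y p‖ * r ^ (2 * (p.1 + p.2)) := by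
  obtain ⟨hx0, hx1⟩ := hx
  obtain ⟨hy0, hy1⟩ := hy
  have hxy : 0 < x * y := mul_pos hx0 hy0
  set W := x + y - x * y with hW
  have hW0 : x * y < W := by nlinarith
  have hW1 : W < 1 := by nlinarith
  have hWp : 0 < W := hxy.trans hW0
  obtain ⟨ρ, h1, h2⟩ := exists_between ((one_lt_div hWp).mpr hW1)
  obtain ⟨M, hM⟩ := exists_nat_ge ‖lam + α + 1‖
  have hρ0 : 0 < ρ := by linarith
  have hWρ : W * ρ < 1 := by
    rw [lt_div_iff₀ hWp] at h2; linarith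
  refine ⟨√ρ, by rw [Real.lt_sqrt]; linarith; norm_num, ?_⟩
  have hxyρ : x * y * ρ < 1 := lt_trans (by gcongr) hWρ
  have sA := kpHC_summable (lam / 2 + α + 1 / 2) (lam / 2 + α) (lam + α + 1)
    (r := x * y * ρ) (by positivity) hxyρ
  have sB := summable_geometric_of_lt_one (r := W * ρ) (by positivity) hWρ
  have sC := (Summable.mul_of_nonneg sA sB (fun n => by positivity)
    (fun n => by positivity)).mul_left (2 ^ M : ℝ)
  refine Summable.of_nonneg_of_le (fun p => by positivity) (fun p => ?_) sC
  have hb := kpCat_norm_le (lam + α) M hM p.1 p.2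
  unfold kpD
  rw [pow_mul, Real.sq_sqrt hρ0.le]
  simp only [norm_mul, norm_pow, Complex.norm_real]
  rw [Real.norm_of_nonneg (by positivity), Real.norm_of_nonneg (by positivity)]
  calc _ ≤ ‖kpHC (lam / 2 + α + 1 / 2) (lam / 2 + α) (lam + α + 1) p.1‖ * (x * y / 4) ^ p.1 *
        (W / 4) ^ p.2 * (2 ^ M * (4 ^ p.1 * 4 ^ p.2)) * ρ ^ (p.1 + p.2) := by gcongr
    _ = _ := by
      simp only [div_pow, mul_pow, pow_add]
      field_simp

/-- Expansion of the transformed integrand. -/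
lemma kpD_hasSum (lam α : ℂ) (hs : -1 < (lam + α).re) {x y : ℝ} (hx : x ∈ Ioo (0 : ℝ) 1)
    (hy : y ∈ Ioo (0 : ℝ) 1) {v X τ : ℝ} (hv : v ∈ Ioo (0 : ℝ) 1) (hX : X ∈ Ioo (0 : ℝ) 1)
    (h1 : X / (1 + X) ^ 2 = (x + y - x * y) / 4 * v ^ 2)
    (h2 : τ = x * y / 4 * v ^ 2 * (1 + X) ^ 2) :
    ∑' p : ℕ × ℕ, kpD lam α x y p * (v : ℂ) ^ (2 * (p.1 + p.2)) =
      ((1 + X : ℝ) : ℂ) ^ (lam + α + 1) / ((1 - X : ℝ) : ℂ) *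
        ∑' n, kpHC (lam / 2 + α + 1 / 2) (lam / 2 + α) (lam + α + 1) n * (τ : ℂ) ^ n := by
  obtain ⟨r, hr, hsum⟩ := kpD_summable lam α hx hy
  have hv0 := hv.1
  have hX0 := hX.1
  have hne : ((1 + X : ℝ) : ℂ) ≠ 0 := by
    rw [Complex.ofReal_ne_zero]; linarith
  have hS : Summable fun p : ℕ × ℕ => kpD lam α x y p * (v : ℂ) ^ (2 * (p.1 + p.2)) := by
    refine Summable.of_norm_bounded hsum fun p => ?_
    rw [norm_mul, norm_pow, Complex.norm_real, Real.norm_of_nonneg hv.1.le]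
    have : v ≤ r := (hv.2.trans hr).le
    gcongr
  rw [hS.tsum_prod, ← tsum_mul_left]
  refine tsum_congr fun n => ?_
  have hc := kp_catalan (lam + α + 2 * n) (by simp; have := hs; simp at this; linarith [Nat.cast_nonneg (α := ℝ) n]) X hX
  rw [h1] at hc
  have hc2 := hc.mul_left (kpHC (lam / 2 + α + 1 / 2) (lam / 2 + α) (lam + α + 1) n *
    ((x * y / 4 : ℝ) : ℂ) ^ n * (v : ℂ) ^ (2 * n))
  have hc3 := kp_hasSum_congr (g := fun k => kpD lam α x y (n, k) * (v : ℂ) ^ (2 * (n + k))) hc2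
    (fun k => by
      unfold kpD
      push_cast
      rw [mul_pow, mul_add, pow_add, ← pow_mul]
      ring)
  rw [hc3.tsum_eq]
  have e : ((1 + X : ℝ) : ℂ) ^ (lam + α + 2 * n + 1) =
      ((1 + X : ℝ) : ℂ) ^ (lam + α + 1) * (((1 + X : ℝ) : ℂ) ^ 2) ^ n := by
    rw [← pow_mul, ← Complex.cpow_natCast, ← Complex.cpow_add _ _ hne]
    congr 1; push_cast; ring
  rw [e, h2]
  push_cast
  rw [mul_pow, mul_pow, pow_mul]
  ring

/-- The beta-type integral of a power series given by a double family. -/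
lemma kp_powint_double (l α : ℂ) (hl : -1 < l.re) (hα : ∀ j : ℕ, α ≠ -j) (d : ℕ × ℕ → ℂ)
    (f : ℕ × ℕ → ℕ) {r : ℝ} (hr : 1 < r) (hd : Summable fun p => ‖d p‖ * r ^ f p)
    (hint : IntegrableOn (fun v : ℝ => (v : ℂ) ^ l * ((1 - v : ℝ) : ℂ) ^ (α - 1) *
      ∑' p, d p * (v : ℂ) ^ f p) (Ioo 0 1)) :
    (Summable fun p => ‖d p * kpB l α (f p)‖) ∧
    ∑' p, d p * kpB l α (f p) = ∫ v in Ioo (0 : ℝ) 1, (v : ℂ) ^ l * ((1 - v : ℝ) : ℂ) ^ (α - 1) *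
      ∑' p, d p * (v : ℂ) ^ f p := by
  have hr0 : 0 < r := by linarith
  have fib : ∀ (g : ℕ → ℂ), (Summable fun p => d p * g (f p)) →
      HasSum (fun m => (∑' q : f ⁻¹' {m}, d q) * g m) (∑' p, d p * g (f p)) := by
    intro g hg
    have := hg.hasSum.tsum_fiberwise f
    refine kp_hasSum_congr this fun m => ?_
    rw [← tsum_mul_right]
    refine tsum_congr fun q => ?_
    have : f q = m := q.2
    rw [this]
  have fibn : Summable fun m => ‖∑' q : f ⁻¹' {m}, d q‖ * r ^ m := by
    have h1 := (hd.hasSum.tsum_fiberwise f).summable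
    refine Summable.of_nonneg_of_le (fun m => by positivity) (fun m => ?_) h1
    have h2 : Summable fun q : f ⁻¹' {m} => ‖d q‖ * r ^ f q :=
      hd.comp_injective Subtype.val_injective
    have h3 : ∀ q : f ⁻¹' {m}, ‖d q‖ * r ^ f q = ‖d q‖ * r ^ m := fun q => by
      have : f q = m := q.2
      rw [this]
    simp only [h3] at h2 ⊢
    rw [tsum_mul_right]
    have h4 : Summable fun q : f ⁻¹' {m} => ‖d q‖ := by
      refine (h2.mul_right (r ^ m)⁻¹).congr fun q => ?_
      field_simp
    gcongr
    exact norm_tsum_le_tsum_norm h4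
  obtain ⟨k, hk⟩ := exists_nat_gt (-α.re)
  have hsv : ∀ v ∈ Ioo (0 : ℝ) 1, ∑' p, d p * (v : ℂ) ^ f p =
      ∑' m, (∑' q : f ⁻¹' {m}, d q) * (v : ℂ) ^ m := by
    intro v hv
    rw [(fib (fun m => (v : ℂ) ^ m) ?_).tsum_eq]
    refine Summable.of_norm_bounded hd fun p => ?_
    rw [norm_mul, norm_pow, Complex.norm_real, Real.norm_of_nonneg hv.1.le]
    have := hv.1
    have : v ≤ r := (hv.2.trans hr).le
    gcongr
  have hB : Summable fun p => ‖d p * kpB l α (f p)‖ := by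
    have h1 := kpB_summable l α hl (r := r⁻¹) (by positivity) (inv_lt_one_of_one_lt₀ hr)
    obtain ⟨C, hC⟩ := h1.tendsto_atTop_zero.bddAbove_range
    refine Summable.of_nonneg_of_le (fun p => norm_nonneg _) (fun p => ?_) (hd.mul_left C)
    have h2 : ‖kpB l α (f p)‖ * r⁻¹ ^ f p ≤ C := hC ⟨f p, rfl⟩
    rw [inv_pow, ← div_eq_mul_inv, div_le_iff₀ (by positivity)] at h2
    rw [norm_mul]
    calc _ ≤ ‖d p‖ * (C * r ^ f p) := by gcongr
      _ = _ := by ring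
  refine ⟨hB, ?_⟩
  have hcongr : EqOn (fun v : ℝ => (v : ℂ) ^ l * ((1 - v : ℝ) : ℂ) ^ (α - 1) *
      ∑' p, d p * (v : ℂ) ^ f p) (fun v : ℝ => (v : ℂ) ^ l * ((1 - v : ℝ) : ℂ) ^ (α - 1) *
      ∑' m, (∑' q : f ⁻¹' {m}, d q) * (v : ℂ) ^ m) (Ioo 0 1) := fun v hv => by
    simp only [hsv v hv]
  have hint2 := hint.congr_fun hcongr measurableSet_Ioo
  have := kp_powint l hl k α (by linarith) hα (fun m => ∑' q : f ⁻¹' {m}, d q) ⟨r, hr, fibn⟩ hint2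
  rw [setIntegral_congr_fun measurableSet_Ioo hcongr]
  exact (fib (kpB l α) hB.of_norm).unique this

lemma kp_asc_double (l : ℂ) (N : ℕ) : (ascPochhammer ℂ (2 * N)).eval (l + 1) =
    4 ^ N * (ascPochhammer ℂ N).eval ((l + 1) / 2) * (ascPochhammer ℂ N).eval ((l + 2) / 2) := by
  induction N with
  | zero => simp
  | succ N ih =>
    rw [show 2 * (N + 1) = 2 * N + 1 + 1 by ring, ascPochhammer_succ_eval,
      ascPochhammer_succ_eval, ih, ascPochhammer_succ_eval, ascPochhammer_succ_eval]
    push_cast; ring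

lemma kp_Gamma_asc (z : ℂ) (hz : 0 < z.re) (n : ℕ) :
    Complex.Gamma (z + n) = Complex.Gamma z * (ascPochhammer ℂ n).eval z := by
  rw [← Complex.Gamma_add_nat_div_Gamma_eq z (fun k h => by
    rw [h] at hz; simp at hz; linarith [Nat.cast_nonneg (α := ℝ) k])]
  have := Complex.Gamma_ne_zero_of_re_pos hz
  field_simp

lemma kpD_mul_kpB (lam α : ℂ) (hl : -1 < lam.re) (hs : -1 < (lam + α).re) (x y : ℝ)
    (p : ℕ × ℕ) :
    kpD lam α x y p * kpB lam α (2 * (p.1 + p.2)) = Complex.Gamma α * Complex.Gamma (lam + 1) *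
      (kpW ((lam + 1) / 2) ((lam + 2) / 2) (lam + α + 1) p.1 (p.1 + p.2) / (p.2.factorial : ℂ) *
        (((x * y) ^ p.1 * (x + y - x * y) ^ p.2 : ℝ) : ℂ)) := by
  obtain ⟨n, k⟩ := p
  simp only [Complex.add_re] at hs
  have g1 : Complex.Gamma (lam + (2 * (n + k) : ℕ) + 1) = Complex.Gamma (lam + 1) *
      (4 ^ (n + k) * (ascPochhammer ℂ (n + k)).eval ((lam + 1) / 2) *
      (ascPochhammer ℂ (n + k)).eval ((lam + 2) / 2)) := by
    rw [← kp_asc_double, ← kp_Gamma_asc _ (by simp; linarith)]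
    congr 1; ring
  have hpos : 0 < (lam + α + 2 * n + k + 1).re := by
    simp; linarith [Nat.cast_nonneg (α := ℝ) n, Nat.cast_nonneg (α := ℝ) k]
  have g2 : Complex.Gamma (lam + (2 * (n + k) : ℕ) + 1 + α) =
      Complex.Gamma (lam + α + 2 * n + k + 1) *
        (ascPochhammer ℂ k).eval (lam + α + 2 * n + k + 1) := by
    rw [← kp_Gamma_asc _ hpos]
    congr 1; push_cast; ring
  have n1 : Complex.Gamma (lam + α + 2 * n + k + 1) ≠ 0 := Complex.Gamma_ne_zero_of_re_pos hpos
  have n2 : (ascPochhammer ℂ k).eval (lam + α + 2 * n + k + 1) ≠ 0 := by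
    have h3 := kp_Gamma_asc _ hpos k
    have h4 : Complex.Gamma (lam + α + 2 * n + k + 1 + k) ≠ 0 :=
      Complex.Gamma_ne_zero_of_re_pos (by
        rw [Complex.add_re, Complex.natCast_re]; linarith [Nat.cast_nonneg (α := ℝ) k])
    rw [h3] at h4
    exact right_ne_zero_of_mul h4
  have hf : (k.factorial : ℂ) ≠ 0 := by exact_mod_cast k.factorial_ne_zero
  unfold kpD kpB kpW kpCat
  simp only
  rw [g1, g2, show lam + α + 1 - (lam + 1) / 2 = lam / 2 + α + 1 / 2 by ring,
    show lam + α + 1 - (lam + 2) / 2 = lam / 2 + α by ring,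
    show lam + α + 1 + (n : ℂ) + ((n + k : ℕ) : ℂ) = lam + α + 2 * n + k + 1 by push_cast; ring]
  push_cast
  rw [div_pow, div_pow, pow_add]
  field_simp

lemma kp_mainint (lam α : ℂ) (hl : -1 < lam.re) (hs : -1 < (lam + α).re) (hα : ∀ j : ℕ, α ≠ -j)
    {x y : ℝ} (hx : x ∈ Ioo (0 : ℝ) 1) (hy : y ∈ Ioo (0 : ℝ) 1)
    (hint : IntegrableOn (fun v : ℝ => (v : ℂ) ^ lam * ((1 - v : ℝ) : ℂ) ^ (α - 1) *
      ∑' p : ℕ × ℕ, kpD lam α x y p * (v : ℂ) ^ (2 * (p.1 + p.2))) (Ioo 0 1)) :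
    ∫ v in Ioo (0 : ℝ) 1, (v : ℂ) ^ lam * ((1 - v : ℝ) : ℂ) ^ (α - 1) *
      ∑' p : ℕ × ℕ, kpD lam α x y p * (v : ℂ) ^ (2 * (p.1 + p.2)) =
    Complex.Gamma α * Complex.Gamma (lam + 1) *
      ((∑' i, kpHC ((lam + 1) / 2) ((lam + 2) / 2) (lam + α + 1) i * (x : ℂ) ^ i) *
       ∑' i, kpHC ((lam + 1) / 2) ((lam + 2) / 2) (lam + α + 1) i * (y : ℂ) ^ i) := by
  obtain ⟨r, hr, hd⟩ := kpD_summable lam α hx hy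
  obtain ⟨s1, s2⟩ := kp_powint_double lam α hl hα (kpD lam α x y) (fun p => 2 * (p.1 + p.2)) hr hd
    hint
  rw [← s2]
  simp only [kpD_mul_kpB lam α hl hs] at s1 ⊢
  rw [tsum_mul_left]
  have hG : Complex.Gamma α * Complex.Gamma (lam + 1) ≠ 0 :=
    mul_ne_zero (Complex.Gamma_ne_zero hα) (Complex.Gamma_ne_zero_of_re_pos (by simp; linarith))
  congr 1
  refine kp_BC _ _ _ (fun n h => ?_) hx hy ?_
  · have := congrArg Complex.re h
    simp at this hs
    linarith [Nat.cast_nonneg (α := ℝ) n]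
  · refine (s1.mul_left ‖Complex.Gamma α * Complex.Gamma (lam + 1)‖⁻¹).congr fun p => ?_
    rw [norm_mul (Complex.Gamma α * Complex.Gamma (lam + 1)), inv_mul_cancel_left₀ (norm_ne_zero_iff.mpr hG), norm_mul, Complex.norm_real,
      Real.norm_of_nonneg]
    have h1 : 0 < x * y := mul_pos hx.1 hy.1
    have h2 : 0 < x + y - x * y := by nlinarith [hx.1, hx.2, hy.1, hy.2]
    positivity

lemma kp_cpow {t : ℝ} (ht : 0 < t) (w : ℂ) : (t : ℂ) ^ w = Complex.exp ((Real.log t : ℂ) * w) := by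
  rw [Complex.cpow_def_of_ne_zero (by exact_mod_cast ht.ne'), Complex.ofReal_log ht.le]

lemma kp_ofexp {t : ℝ} (ht : 0 < t) : (t : ℂ) = Complex.exp (Real.log t : ℂ) := by
  rw [← Complex.ofReal_exp, Real.exp_log ht]

lemma kp_sub_facts {p q z : ℝ} (hp : 0 < p) (_hq : 0 < q) (hpq : q < p ^ 2)
    (hz : p + √(p ^ 2 - q) < z) : 0 < z ∧ p < z ∧ q < z ^ 2 ∧ 0 < z ^ 2 - 2 * p * z + q := by
  have hs := Real.sqrt_nonneg (p ^ 2 - q)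
  have hs2 := Real.sq_sqrt (sub_nonneg.mpr hpq.le)
  set s := √(p ^ 2 - q)
  refine ⟨by linarith, by linarith, by nlinarith, ?_⟩
  nlinarith

lemma kp_psi_image {p q : ℝ} (hp : 0 < p) (hq : 0 < q) (hpq : q < p ^ 2) :
    (fun z : ℝ => 2 * p * z / (z ^ 2 + q)) '' (Ioi (p + √(p ^ 2 - q))) = Ioo 0 1 := by
  ext v
  constructor
  · rintro ⟨z, hz, rfl⟩
    obtain ⟨h1, h2, h3, h4⟩ := kp_sub_facts hp hq hpq hz
    refine ⟨by positivity, ?_⟩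
    simp only
    rw [div_lt_one (by positivity)]
    linarith
  · rintro ⟨h0, h1⟩
    have h2 : p ^ 2 - q < p ^ 2 - v ^ 2 * q := by nlinarith [mul_pos h0 hq]
    have h3 : √(p ^ 2 - q) < √(p ^ 2 - v ^ 2 * q) :=
      Real.sqrt_lt_sqrt (by linarith) h2
    have h4 := Real.sq_sqrt (show 0 ≤ p ^ 2 - v ^ 2 * q by linarith)
    have h5 := Real.sqrt_nonneg (p ^ 2 - q)
    set t := √(p ^ 2 - v ^ 2 * q)
    refine ⟨(p + t) / v, ?_, ?_⟩
    · rw [mem_Ioi, lt_div_iff₀ h0]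
      nlinarith
    · have h6 : v * (((p + t) / v) ^ 2 + q) = 2 * p * ((p + t) / v) := by
        field_simp
        nlinarith
      simp only
      rw [← h6]
      have : ((p + t) / v) ^ 2 + q ≠ 0 := by positivity
      field_simp

lemma kp_psi_inj {p q : ℝ} (hp : 0 < p) (hq : 0 < q) (hpq : q < p ^ 2) :
    InjOn (fun z : ℝ => 2 * p * z / (z ^ 2 + q)) (Ioi (p + √(p ^ 2 - q))) := by
  intro z hz w hw h
  obtain ⟨h1, h2, h3, h4⟩ := kp_sub_facts hp hq hpq hz
  obtain ⟨k1, k2, k3, k4⟩ := kp_sub_facts hp hq hpq hw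
  simp only at h
  rw [div_eq_div_iff (by positivity) (by positivity)] at h
  have h5 : (z - w) * (z * w - q) = 0 := by
    have : p * ((z - w) * (z * w - q)) = 0 := by linarith
    rcases mul_eq_zero.mp this with h | h
    · exact absurd h hp.ne'
    · exact h
  have h6 : q < z * w := by
    have : q ^ 2 < (z * w) ^ 2 := by nlinarith
    exact lt_of_pow_lt_pow_left₀ 2 (by positivity) this
  rcases mul_eq_zero.mp h5 with h | h <;> linarith

lemma kp_psi_deriv {p q : ℝ} (hq : 0 < q) (z : ℝ) :
    HasDerivAt (fun z : ℝ => 2 * p * z / (z ^ 2 + q)) (2 * p * (q - z ^ 2) / (z ^ 2 + q) ^ 2) z := by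
  have h1 : HasDerivAt (fun z : ℝ => 2 * p * z) (2 * p) z := by
    simpa using (hasDerivAt_id z).const_mul (2 * p)
  have h2 : HasDerivAt (fun z : ℝ => z ^ 2 + q) (2 * z) z := by
    simpa using (hasDerivAt_pow 2 z).add_const q
  have h3 : 2 * p * (q - z ^ 2) / (z ^ 2 + q) ^ 2 =
      (2 * p * (z ^ 2 + q) - 2 * p * z * (2 * z)) / (z ^ 2 + q) ^ 2 := by ring
  rw [h3]
  exact h1.div h2 (by positivity)

/-- Pointwise form of the substituted integrand. -/
lemma kp_pointwise (lam α : ℂ) (hs : -1 < (lam + α).re) {x y p q : ℝ} (hx : x ∈ Ioo (0 : ℝ) 1)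
    (hy : y ∈ Ioo (0 : ℝ) 1) (hp : 0 < p) (hq : 0 < q) (hpq : q < p ^ 2)
    (hxy : x * y = 1 / p ^ 2) (hW : x + y - x * y = q / p ^ 2) {z : ℝ}
    (hz : p + √(p ^ 2 - q) < z) :
    |2 * p * (q - z ^ 2) / (z ^ 2 + q) ^ 2| • (((2 * p * z / (z ^ 2 + q) : ℝ) : ℂ) ^ lam *
      ((1 - 2 * p * z / (z ^ 2 + q) : ℝ) : ℂ) ^ (α - 1) *
      ∑' n : ℕ × ℕ, kpD lam α x y n * ((2 * p * z / (z ^ 2 + q) : ℝ) : ℂ) ^ (2 * (n.1 + n.2))) =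
    ((2 * p : ℝ) : ℂ) ^ (lam + 1) * ((z : ℂ) ^ (-lam - 2 * α) *
      ((z ^ 2 - 2 * p * z + q : ℝ) : ℂ) ^ (α - 1) *
      ∑' n, kpHC (lam / 2 + α + 1 / 2) (lam / 2 + α) (lam + α + 1) n * ((1 / z ^ 2 : ℝ) : ℂ) ^ n) := by
  obtain ⟨h1, h2, h3, h4⟩ := kp_sub_facts hp hq hpq hz
  have hv : 2 * p * z / (z ^ 2 + q) ∈ Ioo (0 : ℝ) 1 :=
    kp_psi_image hp hq hpq ▸ ⟨z, hz, rfl⟩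
  have hX : q / z ^ 2 ∈ Ioo (0 : ℝ) 1 := ⟨by positivity, (div_lt_one (by positivity)).mpr h3⟩
  have h5 : 0 < z ^ 2 - q := by linarith
  have h6 : 0 < z ^ 2 + q := by positivity
  rw [kpD_hasSum lam α hs hx hy (τ := 1 / z ^ 2) hv hX (by rw [hW]; field_simp; norm_num)
    (by rw [hxy]; field_simp; norm_num)]
  have e1 : |2 * p * (q - z ^ 2) / (z ^ 2 + q) ^ 2| =
      Real.exp (Real.log (2 * p) + Real.log (z ^ 2 - q) - 2 * Real.log (z ^ 2 + q)) := by
    rw [show 2 * p * (q - z ^ 2) / (z ^ 2 + q) ^ 2 =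
      -(2 * p * (z ^ 2 - q) / (z ^ 2 + q) ^ 2) by ring, abs_neg, abs_of_pos (by positivity),
      Real.exp_sub, Real.exp_add, Real.exp_log (by positivity), Real.exp_log h5,
      two_mul (Real.log _), Real.exp_add, Real.exp_log h6, sq (z ^ 2 + q)]
  have e2 : 1 - 2 * p * z / (z ^ 2 + q) = (z ^ 2 - 2 * p * z + q) / (z ^ 2 + q) := by
    field_simp; ring
  have e3 : 1 + q / z ^ 2 = (z ^ 2 + q) / z ^ 2 := by field_simp
  have e4 : 1 - q / z ^ 2 = (z ^ 2 - q) / z ^ 2 := by field_simp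
  rw [e2, e3, e4, Complex.real_smul, e1]
  rw [kp_cpow (t := 2 * p * z / (z ^ 2 + q)) (by positivity),
    kp_cpow (t := (z ^ 2 - 2 * p * z + q) / (z ^ 2 + q)) (by positivity),
    kp_cpow (t := (z ^ 2 + q) / z ^ 2) (by positivity),
    kp_cpow (t := 2 * p) (by positivity), kp_cpow h1, kp_cpow h4,
    kp_ofexp (t := (z ^ 2 - q) / z ^ 2) (by positivity),
    Real.log_div (by positivity) (by positivity), Real.log_div (by positivity) (by positivity),
    Real.log_div (by positivity) (by positivity), Real.log_div (by positivity) (by positivity),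
    Real.log_mul (x := 2 * p) (y := z) (by positivity) (by positivity), Real.log_pow]
  generalize Real.log (2 * p) = A
  generalize Real.log (z ^ 2 - q) = B
  generalize Real.log (z ^ 2 + q) = C
  generalize Real.log (z ^ 2 - 2 * p * z + q) = D
  generalize Real.log z = E
  generalize ∑' n, kpHC (lam / 2 + α + 1 / 2) (lam / 2 + α) (lam + α + 1) n *
    ((1 / z ^ 2 : ℝ) : ℂ) ^ n = S
  push_cast
  rw [← Complex.exp_sub]
  simp only [← mul_assoc, ← Complex.exp_add]
  congr 2
  ring

lemma kp_integral (lam α : ℂ) (hl : -1 < lam.re) (hs : -1 < (lam + α).re) (hα : ∀ j : ℕ, α ≠ -j)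
    {x y p q : ℝ} (hx : x ∈ Ioo (0 : ℝ) 1)
    (hy : y ∈ Ioo (0 : ℝ) 1) (hp : 0 < p) (hq : 0 < q) (hpq : q < p ^ 2)
    (hxy : x * y = 1 / p ^ 2) (hW : x + y - x * y = q / p ^ 2)
    (hint : IntegrableOn (fun z : ℝ => (z : ℂ) ^ (-lam - 2 * α) *
      ((z ^ 2 - 2 * p * z + q : ℝ) : ℂ) ^ (α - 1) *
      ∑' n, kpHC (lam / 2 + α + 1 / 2) (lam / 2 + α) (lam + α + 1) n * ((1 / z ^ 2 : ℝ) : ℂ) ^ n)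
      (Ioi (p + √(p ^ 2 - q)))) :
    ((2 * p : ℝ) : ℂ) ^ (lam + 1) * ∫ z in Ioi (p + √(p ^ 2 - q)), (z : ℂ) ^ (-lam - 2 * α) *
      ((z ^ 2 - 2 * p * z + q : ℝ) : ℂ) ^ (α - 1) *
      ∑' n, kpHC (lam / 2 + α + 1 / 2) (lam / 2 + α) (lam + α + 1) n * ((1 / z ^ 2 : ℝ) : ℂ) ^ n =
    Complex.Gamma α * Complex.Gamma (lam + 1) *
      ((∑' i, kpHC ((lam + 1) / 2) ((lam + 2) / 2) (lam + α + 1) i * (x : ℂ) ^ i) *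
       ∑' i, kpHC ((lam + 1) / 2) ((lam + 2) / 2) (lam + α + 1) i * (y : ℂ) ^ i) := by
  have hd : ∀ z ∈ Ioi (p + √(p ^ 2 - q)), HasDerivWithinAt (fun z : ℝ => 2 * p * z / (z ^ 2 + q))
      (2 * p * (q - z ^ 2) / (z ^ 2 + q) ^ 2) (Ioi (p + √(p ^ 2 - q))) z :=
    fun z _ => (kp_psi_deriv hq z).hasDerivWithinAt
  have hinj := kp_psi_inj hp hq hpq
  have himg := kp_psi_image hp hq hpq
  have hpt : EqOn (fun z : ℝ => |2 * p * (q - z ^ 2) / (z ^ 2 + q) ^ 2| •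
      (((2 * p * z / (z ^ 2 + q) : ℝ) : ℂ) ^ lam *
      ((1 - 2 * p * z / (z ^ 2 + q) : ℝ) : ℂ) ^ (α - 1) *
      ∑' n : ℕ × ℕ, kpD lam α x y n * ((2 * p * z / (z ^ 2 + q) : ℝ) : ℂ) ^ (2 * (n.1 + n.2))))
      (fun z : ℝ => ((2 * p : ℝ) : ℂ) ^ (lam + 1) * ((z : ℂ) ^ (-lam - 2 * α) *
      ((z ^ 2 - 2 * p * z + q : ℝ) : ℂ) ^ (α - 1) *
      ∑' n, kpHC (lam / 2 + α + 1 / 2) (lam / 2 + α) (lam + α + 1) n * ((1 / z ^ 2 : ℝ) : ℂ) ^ n))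
      (Ioi (p + √(p ^ 2 - q))) :=
    fun z hz => kp_pointwise lam α hs hx hy hp hq hpq hxy hW hz
  have key := kp_mainint lam α hl hs hα hx hy ?_
  · rw [← key, ← himg, integral_image_eq_integral_abs_deriv_smul measurableSet_Ioi hd hinj,
      setIntegral_congr_fun measurableSet_Ioi hpt, integral_const_mul]
  · rw [← himg, integrableOn_image_iff_integrableOn_abs_deriv_smul measurableSet_Ioi hd hinj]
    have h9 : IntegrableOn _ (Ioi (p + √(p ^ 2 - q))) :=
      hint.const_mul (((2 * p : ℝ) : ℂ) ^ (lam + 1))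
    exact h9.congr_fun hpt.symm measurableSet_Ioi

lemma kp_gD (lam α : ℂ) {z : ℝ} :
    gegenbauerD lam α z = Complex.exp ((Real.pi : ℂ) * Complex.I * α) *
      (Complex.Gamma (lam + 2 * α) / Complex.Gamma α) * ((2 * z : ℝ) : ℂ) ^ (-lam - 2 * α) *
      ∑' n, kpHC (lam / 2 + α + 1 / 2) (lam / 2 + α) (lam + α + 1) n *
        ((1 / z ^ 2 : ℝ) : ℂ) ^ n := by
  unfold gegenbauerD hyp2F1reg kpHC
  push_cast
  congr 1
  refine tsum_congr fun n => ?_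
  ring

/-- The integrand written through the normalised kernel. -/
lemma kp_F_eq (lam α : ℂ) {z₁ z₂ z : ℝ} (hz₁ : 1 < z₁) (hz₂ : 1 < z₂)
    (hz : z₁ * z₂ + √((z₁ * z₂) ^ 2 - (z₁ ^ 2 + z₂ ^ 2 - 1)) < z) :
    gegenbauerD lam α z * (((z₁ ^ 2 + z₂ ^ 2 + z ^ 2 - 1) / (2 * z₁ * z₂) - z : ℝ) : ℂ) ^ (α - 1) =
    Complex.exp ((Real.pi : ℂ) * Complex.I * α) *
      (Complex.Gamma (lam + 2 * α) / Complex.Gamma α) *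
      Complex.exp ((Real.log 2 : ℂ) * (-lam - 2 * α) +
        (Real.log (2 * (z₁ * z₂)) : ℂ) * (1 - α)) *
      ((z : ℂ) ^ (-lam - 2 * α) *
        ((z ^ 2 - 2 * (z₁ * z₂) * z + (z₁ ^ 2 + z₂ ^ 2 - 1) : ℝ) : ℂ) ^ (α - 1) *
        ∑' n, kpHC (lam / 2 + α + 1 / 2) (lam / 2 + α) (lam + α + 1) n *
          ((1 / z ^ 2 : ℝ) : ℂ) ^ n) := by
  have hp : 0 < z₁ * z₂ := by positivity
  have hq : 0 < z₁ ^ 2 + z₂ ^ 2 - 1 := by nlinarith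
  have hpq : z₁ ^ 2 + z₂ ^ 2 - 1 < (z₁ * z₂) ^ 2 := by
    have : 0 < (z₁ ^ 2 - 1) * (z₂ ^ 2 - 1) := mul_pos (by nlinarith) (by nlinarith)
    nlinarith
  obtain ⟨h1, h2, h3, h4⟩ := kp_sub_facts hp hq hpq hz
  have e : (z₁ ^ 2 + z₂ ^ 2 + z ^ 2 - 1) / (2 * z₁ * z₂) - z =
      (z ^ 2 - 2 * (z₁ * z₂) * z + (z₁ ^ 2 + z₂ ^ 2 - 1)) / (2 * (z₁ * z₂)) := by
    field_simp; ring
  rw [kp_gD, e, kp_cpow (t := 2 * z) (by positivity), kp_cpow (by positivity), kp_cpow h1,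
    kp_cpow h4, Real.log_div h4.ne' (by positivity),
    Real.log_mul (x := 2) (y := z) (by norm_num) h1.ne']
  generalize Real.log (2 * (z₁ * z₂)) = A
  generalize Real.log (z ^ 2 - 2 * (z₁ * z₂) * z + (z₁ ^ 2 + z₂ ^ 2 - 1)) = B
  generalize Real.log z = C
  generalize Real.log 2 = D
  generalize ∑' n, kpHC (lam / 2 + α + 1 / 2) (lam / 2 + α) (lam + α + 1) n *
    ((1 / z ^ 2 : ℝ) : ℂ) ^ n = S
  push_cast
  have e2 : Complex.exp ((D + C : ℂ) * (-lam - 2 * α)) * Complex.exp ((B - A : ℂ) * (α - 1)) =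
      Complex.exp (D * (-lam - 2 * α) + A * (1 - α)) *
        (Complex.exp (C * (-lam - 2 * α)) * Complex.exp (B * (α - 1))) := by
    simp only [← Complex.exp_add]
    congr 1; ring
  linear_combination (Complex.exp ((Real.pi : ℂ) * Complex.I * α) *
    (Complex.Gamma (lam + 2 * α) / Complex.Gamma α) * S) * e2

lemma kp_case1 (lam α : ℂ) (hl : -1 < lam.re) (h : 0 < (lam + 2 * α).re)
    (hα : ∀ j : ℕ, α ≠ -j) (z₁ z₂ : ℝ) (hz₁ : 1 < z₁) (hz₂ : 1 < z₂)
    (hint : IntegrableOn (fun z : ℝ => (z : ℂ) ^ (-lam - 2 * α) *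
        ((z ^ 2 - 2 * (z₁ * z₂) * z + (z₁ ^ 2 + z₂ ^ 2 - 1) : ℝ) : ℂ) ^ (α - 1) *
        ∑' n, kpHC (lam / 2 + α + 1 / 2) (lam / 2 + α) (lam + α + 1) n *
          ((1 / z ^ 2 : ℝ) : ℂ) ^ n)
        (Ioi (z₁ * z₂ + √((z₁ * z₂) ^ 2 - (z₁ ^ 2 + z₂ ^ 2 - 1))))) :
    gegenbauerD lam α z₁ * gegenbauerD lam α z₂ =
      Complex.exp ((Real.pi : ℂ) * Complex.I * α) * Complex.Gamma (lam + 2 * α) *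
          ((z₁ * z₂ : ℝ) : ℂ) ^ (α - 1) /
        ((2 : ℂ) ^ α * Complex.Gamma (lam + 1) * Complex.Gamma α ^ 2 *
          ((z₁ ^ 2 - 1 : ℝ) : ℂ) ^ (α - 1 / 2) * ((z₂ ^ 2 - 1 : ℝ) : ℂ) ^ (α - 1 / 2)) *
        ∫ z in Ioi (z₁ * z₂ + √((z₁ * z₂) ^ 2 - (z₁ ^ 2 + z₂ ^ 2 - 1))),
          gegenbauerD lam α z *
            (((z₁ ^ 2 + z₂ ^ 2 + z ^ 2 - 1) / (2 * z₁ * z₂) - z : ℝ) : ℂ) ^ (α - 1) := by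
  have hp : 0 < z₁ * z₂ := by positivity
  have hq : 0 < z₁ ^ 2 + z₂ ^ 2 - 1 := by nlinarith
  have hm1 : 0 < z₁ ^ 2 - 1 := by nlinarith
  have hm2 : 0 < z₂ ^ 2 - 1 := by nlinarith
  have hpq : z₁ ^ 2 + z₂ ^ 2 - 1 < (z₁ * z₂) ^ 2 := by
    have : 0 < (z₁ ^ 2 - 1) * (z₂ ^ 2 - 1) := mul_pos hm1 hm2
    nlinarith
  have hs : -1 < (lam + α).re := by simp at h ⊢; linarith
  have hx : 1 / z₁ ^ 2 ∈ Ioo (0 : ℝ) 1 :=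
    ⟨by positivity, (div_lt_one (by positivity)).mpr (by linarith)⟩
  have hy : 1 / z₂ ^ 2 ∈ Ioo (0 : ℝ) 1 :=
    ⟨by positivity, (div_lt_one (by positivity)).mpr (by linarith)⟩
  have hI := kp_integral lam α hl hs hα hx hy hp hq hpq (by field_simp)
    (by field_simp; ring) hint
  rw [setIntegral_congr_fun measurableSet_Ioi (fun z hz => kp_F_eq lam α hz₁ hz₂ hz),
    integral_const_mul]
  have hc : ∀ n : ℕ, lam + α + 1 + n ≠ 0 := fun n h0 => by
    have := congrArg Complex.re h0
    simp at this hs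
    linarith [Nat.cast_nonneg (α := ℝ) n]
  have eu : ∀ x ∈ Ioo (0 : ℝ) 1,
      ∑' n, kpHC (lam / 2 + α + 1 / 2) (lam / 2 + α) (lam + α + 1) n * (x : ℂ) ^ n =
      ((1 - x : ℝ) : ℂ) ^ (1 / 2 - α) *
        ∑' n, kpHC ((lam + 1) / 2) ((lam + 2) / 2) (lam + α + 1) n * (x : ℂ) ^ n := by
    intro x hx
    have := kp_euler ((lam + 1) / 2) ((lam + 2) / 2) (lam + α + 1) hc x hx
    rw [show lam + α + 1 - (lam + 1) / 2 = lam / 2 + α + 1 / 2 by ring,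
      show lam + α + 1 - (lam + 2) / 2 = lam / 2 + α by ring,
      show (lam + 1) / 2 + (lam + 2) / 2 - (lam + α + 1) = 1 / 2 - α by ring] at this
    exact this
  rw [kp_gD, kp_gD, eu _ hx, eu _ hy]
  have hG1 : Complex.Gamma (lam + 1) ≠ 0 := Complex.Gamma_ne_zero_of_re_pos (by simp; linarith)
  have hGa : Complex.Gamma α ≠ 0 := Complex.Gamma_ne_zero hα
  generalize (∑' n, kpHC ((lam + 1) / 2) ((lam + 2) / 2) (lam + α + 1) n *
    ((1 / z₁ ^ 2 : ℝ) : ℂ) ^ n) = Fx at hI ⊢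
  generalize (∑' n, kpHC ((lam + 1) / 2) ((lam + 2) / 2) (lam + α + 1) n *
    ((1 / z₂ ^ 2 : ℝ) : ℂ) ^ n) = Fy at hI ⊢
  generalize (∫ z in Ioi (z₁ * z₂ + √((z₁ * z₂) ^ 2 - (z₁ ^ 2 + z₂ ^ 2 - 1))),
    (z : ℂ) ^ (-lam - 2 * α) *
        ((z ^ 2 - 2 * (z₁ * z₂) * z + (z₁ ^ 2 + z₂ ^ 2 - 1) : ℝ) : ℂ) ^ (α - 1) *
        ∑' n, kpHC (lam / 2 + α + 1 / 2) (lam / 2 + α) (lam + α + 1) n *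
          ((1 / z ^ 2 : ℝ) : ℂ) ^ n) = J at hI ⊢
  have hJ : J = Complex.exp (-((Real.log (2 * (z₁ * z₂)) : ℂ) * (lam + 1))) *
      (Complex.Gamma α * Complex.Gamma (lam + 1) * (Fx * Fy)) := by
    rw [← hI, kp_cpow (by positivity), ← mul_assoc, ← Complex.exp_add]
    simp
  rw [hJ]
  have e1 : 1 - 1 / z₁ ^ 2 = (z₁ ^ 2 - 1) / z₁ ^ 2 := by field_simp
  have e2 : 1 - 1 / z₂ ^ 2 = (z₂ ^ 2 - 1) / z₂ ^ 2 := by field_simp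
  have e3 : (2 : ℂ) ^ α = ((2 : ℝ) : ℂ) ^ α := by simp
  rw [e1, e2, e3, kp_cpow (t := 2 * z₁) (by positivity), kp_cpow (t := 2 * z₂) (by positivity),
    kp_cpow (t := (z₁ ^ 2 - 1) / z₁ ^ 2) (by positivity),
    kp_cpow (t := (z₂ ^ 2 - 1) / z₂ ^ 2) (by positivity), kp_cpow hp, kp_cpow hm1, kp_cpow hm2,
    kp_cpow (t := 2) (by norm_num), Real.log_div hm1.ne' (by positivity),
    Real.log_div hm2.ne' (by positivity), Real.log_mul (x := 2) (y := z₁ * z₂) (by norm_num) hp.ne',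
    Real.log_mul (x := z₁) (y := z₂) (by positivity) (by positivity),
    Real.log_mul (x := 2) (y := z₁) (by norm_num) (by positivity),
    Real.log_mul (x := 2) (y := z₂) (by norm_num) (by positivity), Real.log_pow, Real.log_pow]
  generalize Real.log (z₁ ^ 2 - 1) = M1
  generalize Real.log (z₂ ^ 2 - 1) = M2
  generalize Real.log z₁ = L1
  generalize Real.log z₂ = L2
  generalize Real.log 2 = T
  generalize Complex.exp ((Real.pi : ℂ) * Complex.I * α) = E
  generalize Complex.Gamma (lam + 2 * α) = G
  generalize Complex.Gamma (lam + 1) = G1 at *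
  generalize Complex.Gamma α = Ga at *
  push_cast
  rw [show E * G * Complex.exp (((L1 : ℂ) + L2) * (α - 1)) /
      (Complex.exp (T * α) * G1 * Ga ^ 2 * Complex.exp (M1 * (α - 1 / 2)) *
        Complex.exp (M2 * (α - 1 / 2))) *
      (E * (G / Ga) * Complex.exp (T * (-lam - 2 * α) + (T + (L1 + L2)) * (1 - α)) *
      (Complex.exp (-((T + (L1 + L2)) * (lam + 1))) * (Ga * G1 * (Fx * Fy)))) =
      E * (G / Ga) * (E * (G / Ga)) * Fx * Fy * (Complex.exp (((L1 : ℂ) + L2) * (α - 1)) *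
        Complex.exp (T * (-lam - 2 * α) + (T + (L1 + L2)) * (1 - α)) *
        Complex.exp (-((T + (L1 + L2)) * (lam + 1))) / (Complex.exp (T * α) *
        Complex.exp (M1 * (α - 1 / 2)) * Complex.exp (M2 * (α - 1 / 2)))) by
      field_simp]
  have e4 : Complex.exp (((L1 : ℂ) + L2) * (α - 1)) *
        Complex.exp (T * (-lam - 2 * α) + (T + (L1 + L2)) * (1 - α)) *
        Complex.exp (-((T + (L1 + L2)) * (lam + 1))) / (Complex.exp (T * α) *
        Complex.exp (M1 * (α - 1 / 2)) * Complex.exp (M2 * (α - 1 / 2))) =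
      Complex.exp ((T + L1) * (-lam - 2 * α)) * Complex.exp ((T + L2) * (-lam - 2 * α)) *
      Complex.exp ((M1 - 2 * L1) * (1 / 2 - α)) * Complex.exp ((M2 - 2 * L2) * (1 / 2 - α)) := by
    simp only [← Complex.exp_add, ← Complex.exp_sub]
    congr 1; ring
  rw [e4]
  ring

lemma kp_growth (lam α : ℂ) {p q : ℝ} (hp : 0 < p) (hq : 0 < q) (hpq : q < p ^ 2)
    (hc : ∀ n : ℕ, lam + α + 1 + n ≠ 0)
    (hint : IntegrableOn (fun z : ℝ => (z : ℂ) ^ (-lam - 2 * α) *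
      ((z ^ 2 - 2 * p * z + q : ℝ) : ℂ) ^ (α - 1) *
      ∑' n, kpHC (lam / 2 + α + 1 / 2) (lam / 2 + α) (lam + α + 1) n * ((1 / z ^ 2 : ℝ) : ℂ) ^ n)
      (Ioi (p + √(p ^ 2 - q)))) : -1 < lam.re := by
  set S : ℂ → ℂ := fun w =>
    ∑' n, kpHC (lam / 2 + α + 1 / 2) (lam / 2 + α) (lam + α + 1) n * w ^ n with hS
  have hcont : ContinuousAt S 0 :=
    (kp_hasDeriv (kpHC (lam / 2 + α + 1 / 2) (lam / 2 + α) (lam + α + 1)) 1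
      (fun r h0 h1 => kpHC_summable _ _ _ h0 h1) 0 (by simp)).continuousAt
  have hS0 : S 0 = (Complex.Gamma (lam + α + 1))⁻¹ := by
    simp only [hS]
    rw [tsum_eq_single 0 (fun n hn => by simp [hn])]
    simp [kpHC]
  have hS0n : S 0 ≠ 0 := by
    rw [hS0]
    refine inv_ne_zero (Complex.Gamma_ne_zero fun m h => hc m ?_)
    rw [h]; ring
  have t0 : Tendsto (fun z : ℝ => z⁻¹) atTop (𝓝 0) := tendsto_inv_atTop_zero
  have t1 : Tendsto (fun z : ℝ => ((1 / z ^ 2 : ℝ) : ℂ)) atTop (𝓝 0) := by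
    have : Tendsto (fun z : ℝ => 1 / z ^ 2) atTop (𝓝 0) := by
      have h1 := t0.mul t0
      simp only [mul_zero] at h1
      refine h1.congr fun z => ?_
      rw [one_div, sq, mul_inv]
    have h2 := (Complex.continuous_ofReal.tendsto 0).comp this
    rw [Complex.ofReal_zero] at h2
    exact h2
  have t2 : Tendsto (fun z : ℝ => ‖S ((1 / z ^ 2 : ℝ) : ℂ)‖) atTop (𝓝 ‖S 0‖) :=
    (hcont.tendsto.comp t1).norm
  have t3 : Tendsto (fun z : ℝ => (z ^ 2 - 2 * p * z + q) / z ^ 2) atTop (𝓝 1) := by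
    have h1 : Tendsto (fun z : ℝ => 1 - 2 * p * z⁻¹ + q * (z⁻¹ * z⁻¹)) atTop
        (𝓝 (1 - 2 * p * 0 + q * (0 * 0))) :=
      (tendsto_const_nhds.sub (t0.const_mul _)).add ((t0.mul t0).const_mul _)
    simp only [mul_zero, sub_zero, add_zero] at h1
    refine h1.congr' ?_
    filter_upwards [eventually_gt_atTop 0] with z hz
    field_simp
  have t4 : Tendsto (fun z : ℝ => ((z ^ 2 - 2 * p * z + q) / z ^ 2) ^ (α.re - 1) *
      ‖S ((1 / z ^ 2 : ℝ) : ℂ)‖) atTop (𝓝 (1 * ‖S 0‖)) := by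
    refine Tendsto.mul ?_ t2
    have := t3.rpow_const (p := α.re - 1) (Or.inl one_ne_zero)
    simpa using this
  have hpos : 0 < ‖S 0‖ := norm_pos_iff.mpr hS0n
  have hev := (t4.eventually (lt_mem_nhds (show ‖S 0‖ / 2 < 1 * ‖S 0‖ by linarith)))
  obtain ⟨B, hB⟩ := (hev.and ((eventually_gt_atTop (p + √(p ^ 2 - q))).and
    (eventually_gt_atTop 0))).exists_forall_of_atTop
  obtain ⟨-, hB1, hB0⟩ := hB B le_rfl
  have hint2 := (hint.mono_set (Ioi_subset_Ioi hB1.le)).norm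
  have key : IntegrableOn (fun z : ℝ => z ^ (-lam.re - 2)) (Ioi B) := by
    refine Integrable.mono' (hint2.const_mul (2 / ‖S 0‖)) ?_ ?_
    · refine (ContinuousOn.aestronglyMeasurable (fun z hz => ?_) measurableSet_Ioi)
      exact (Real.continuousAt_rpow_const _ _ (Or.inl (hB0.trans hz).ne')).continuousWithinAt
    · filter_upwards [ae_restrict_mem measurableSet_Ioi] with z hz
      obtain ⟨h1, h2, h3⟩ := hB z (le_of_lt hz)
      obtain ⟨-, -, -, h4⟩ := kp_sub_facts hp hq hpq h2
      rw [Real.norm_of_nonneg (by positivity), norm_mul, norm_mul,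
        Complex.norm_cpow_eq_rpow_re_of_pos h3, Complex.norm_cpow_eq_rpow_re_of_pos h4]
      have e : z ^ ((-lam - 2 * α).re) * (z ^ 2 - 2 * p * z + q) ^ ((α - 1).re) =
          z ^ (-lam.re - 2) * ((z ^ 2 - 2 * p * z + q) / z ^ 2) ^ (α.re - 1) := by
        rw [Real.div_rpow h4.le (by positivity), ← Real.rpow_natCast z 2, ← Real.rpow_mul h3.le,
          mul_div_assoc', mul_comm (z ^ (-lam.re - 2)), mul_div_assoc, ← Real.rpow_sub h3]
        rw [mul_comm]
        congr 2
        simp; ring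
      rw [e]
      have h5 : 0 < z ^ (-lam.re - 2) := by positivity
      calc z ^ (-lam.re - 2) = 2 / ‖S 0‖ * (z ^ (-lam.re - 2) * (‖S 0‖ / 2)) := by field_simp
        _ ≤ 2 / ‖S 0‖ * (z ^ (-lam.re - 2) * (((z ^ 2 - 2 * p * z + q) / z ^ 2) ^ (α.re - 1) *
          ‖S ((1 / z ^ 2 : ℝ) : ℂ)‖)) := by gcongr
        _ = _ := by ring
  rw [integrableOn_Ioi_rpow_iff hB0] at key
  linarith

lemma kp_case2 (lam α : ℂ) (h : 0 < (lam + 2 * α).re)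
    (hα : ∀ j : ℕ, α ≠ -j) (hc : ∀ n : ℕ, lam + α + 1 + n ≠ 0)
    (z₁ z₂ : ℝ) (hz₁ : 1 < z₁) (hz₂ : 1 < z₂)
    (hint : IntegrableOn (fun z : ℝ => gegenbauerD lam α z *
            (((z₁ ^ 2 + z₂ ^ 2 + z ^ 2 - 1) / (2 * z₁ * z₂) - z : ℝ) : ℂ) ^ (α - 1))
        (Ioi (z₁ * z₂ + √((z₁ * z₂) ^ 2 - (z₁ ^ 2 + z₂ ^ 2 - 1))))) :
    -1 < lam.re ∧ gegenbauerD lam α z₁ * gegenbauerD lam α z₂ =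
      Complex.exp ((Real.pi : ℂ) * Complex.I * α) * Complex.Gamma (lam + 2 * α) *
          ((z₁ * z₂ : ℝ) : ℂ) ^ (α - 1) /
        ((2 : ℂ) ^ α * Complex.Gamma (lam + 1) * Complex.Gamma α ^ 2 *
          ((z₁ ^ 2 - 1 : ℝ) : ℂ) ^ (α - 1 / 2) * ((z₂ ^ 2 - 1 : ℝ) : ℂ) ^ (α - 1 / 2)) *
        ∫ z in Ioi (z₁ * z₂ + √((z₁ * z₂) ^ 2 - (z₁ ^ 2 + z₂ ^ 2 - 1))),
          gegenbauerD lam α z *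
            (((z₁ ^ 2 + z₂ ^ 2 + z ^ 2 - 1) / (2 * z₁ * z₂) - z : ℝ) : ℂ) ^ (α - 1) := by
  have hp : 0 < z₁ * z₂ := by positivity
  have hq : 0 < z₁ ^ 2 + z₂ ^ 2 - 1 := by nlinarith
  have hpq : z₁ ^ 2 + z₂ ^ 2 - 1 < (z₁ * z₂) ^ 2 := by
    have : 0 < (z₁ ^ 2 - 1) * (z₂ ^ 2 - 1) := mul_pos (by nlinarith) (by nlinarith)
    nlinarith
  have hint1 := hint.congr_fun (fun z hz => kp_F_eq lam α hz₁ hz₂ hz) measurableSet_Ioi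
  set κ : ℂ := Complex.exp ((Real.pi : ℂ) * Complex.I * α) *
      (Complex.Gamma (lam + 2 * α) / Complex.Gamma α) *
      Complex.exp ((Real.log 2 : ℂ) * (-lam - 2 * α) +
        (Real.log (2 * (z₁ * z₂)) : ℂ) * (1 - α)) with hκ
  have hκ0 : κ ≠ 0 := mul_ne_zero (mul_ne_zero (Complex.exp_ne_zero _)
    (div_ne_zero (Complex.Gamma_ne_zero_of_re_pos h) (Complex.Gamma_ne_zero hα)))
    (Complex.exp_ne_zero _)
  have hint2 : IntegrableOn (fun z : ℝ => (z : ℂ) ^ (-lam - 2 * α) *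
        ((z ^ 2 - 2 * (z₁ * z₂) * z + (z₁ ^ 2 + z₂ ^ 2 - 1) : ℝ) : ℂ) ^ (α - 1) *
        ∑' n, kpHC (lam / 2 + α + 1 / 2) (lam / 2 + α) (lam + α + 1) n *
          ((1 / z ^ 2 : ℝ) : ℂ) ^ n)
        (Ioi (z₁ * z₂ + √((z₁ * z₂) ^ 2 - (z₁ ^ 2 + z₂ ^ 2 - 1)))) := by
    refine (hint1.const_mul κ⁻¹).congr (Filter.Eventually.of_forall fun z => ?_)
    simp only
    rw [inv_mul_cancel_left₀ hκ0]
  have hl := kp_growth lam α hp hq hpq hc hint2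
  exact ⟨hl, kp_case1 lam α hl h hα z₁ z₂ hz₁ hz₂ hint2⟩

lemma kp_asc_add (A : ℂ) (M n : ℕ) : (ascPochhammer ℂ (n + M)).eval A =
    (ascPochhammer ℂ M).eval A * (ascPochhammer ℂ n).eval (A + M) := by
  rw [add_comm, ← ascPochhammer_mul]
  simp [Polynomial.eval_comp]

lemma kp_D_shift (lam α : ℂ) (h : 0 < (lam + 2 * α).re) (M : ℕ) (hM : lam + α + M = 0) {z : ℝ}
    (hz : 1 < z) : gegenbauerD lam α z = gegenbauerD (lam + 2 * M) α z := by
  have hx0 : 0 ≤ 1 / z ^ 2 := by positivity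
  have hx1 : 1 / z ^ 2 < 1 := (div_lt_one (by positivity)).mpr (by nlinarith)
  have hsum : Summable fun n => kpHC (lam / 2 + α + 1 / 2) (lam / 2 + α) (lam + α + 1) n *
      ((1 / z ^ 2 : ℝ) : ℂ) ^ n :=
    kp_summable_ps _ 1 (fun r h0 h1 => kpHC_summable _ _ _ h0 h1) _ (by
      rw [Complex.norm_real, Real.norm_of_nonneg hx0]; exact hx1)
  rw [kp_gD, kp_gD, ← hsum.sum_add_tsum_nat_add M, Finset.sum_eq_zero, zero_add]
  · have hterm : ∀ n, kpHC (lam / 2 + α + 1 / 2) (lam / 2 + α) (lam + α + 1) (n + M) =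
        (ascPochhammer ℂ M).eval (lam / 2 + α + 1 / 2) * (ascPochhammer ℂ M).eval (lam / 2 + α) *
        kpHC ((lam + 2 * M) / 2 + α + 1 / 2) ((lam + 2 * M) / 2 + α) (lam + 2 * M + α + 1) n := by
      intro n
      unfold kpHC
      rw [kp_asc_add, kp_asc_add,
        show lam + α + 1 + ((n + M : ℕ) : ℂ) = (n : ℂ) + 1 by push_cast; linear_combination hM,
        show lam + 2 * M + α + 1 + (n : ℂ) = ((n + M : ℕ) : ℂ) + 1 by
          push_cast; linear_combination hM,
        Complex.Gamma_nat_eq_factorial, Complex.Gamma_nat_eq_factorial,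
        show (lam + 2 * M) / 2 + α + 1 / 2 = lam / 2 + α + 1 / 2 + (M : ℂ) by ring,
        show (lam + 2 * M) / 2 + α = lam / 2 + α + (M : ℂ) by ring]
      ring
    have hsh : ∀ n, kpHC (lam / 2 + α + 1 / 2) (lam / 2 + α) (lam + α + 1) (n + M) *
        ((1 / z ^ 2 : ℝ) : ℂ) ^ (n + M) =
        ((ascPochhammer ℂ M).eval (lam / 2 + α + 1 / 2) * (ascPochhammer ℂ M).eval (lam / 2 + α) *
          ((1 / z ^ 2 : ℝ) : ℂ) ^ M) *
        (kpHC ((lam + 2 * M) / 2 + α + 1 / 2) ((lam + 2 * M) / 2 + α) (lam + 2 * M + α + 1) n *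
          ((1 / z ^ 2 : ℝ) : ℂ) ^ n) := by
      intro n
      rw [hterm, pow_add]; ring
    simp only [hsh]
    rw [tsum_mul_left]
    have hG : Complex.Gamma (lam + 2 * M + 2 * α) = Complex.Gamma (lam + 2 * α) *
        (4 ^ M * (ascPochhammer ℂ M).eval (lam / 2 + α) *
          (ascPochhammer ℂ M).eval (lam / 2 + α + 1 / 2)) := by
      have h1 := kp_Gamma_asc (lam + 2 * α) h (2 * M)
      have h2 := kp_asc_double (lam + 2 * α - 1) M
      rw [show lam + 2 * α - 1 + 1 = lam + 2 * α by ring,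
        show (lam + 2 * α) / 2 = lam / 2 + α by ring,
        show (lam + 2 * α - 1 + 2) / 2 = lam / 2 + α + 1 / 2 by ring] at h2
      rw [h2] at h1
      rw [← h1]
      congr 1; push_cast; ring
    have hz0 : ((2 * z : ℝ) : ℂ) ≠ 0 := by
      rw [Complex.ofReal_ne_zero]; positivity
    have hzc : (z : ℂ) ≠ 0 := by
      rw [Complex.ofReal_ne_zero]; positivity
    have hpw : ((2 * z : ℝ) : ℂ) ^ (-lam - 2 * α) * ((1 / z ^ 2 : ℝ) : ℂ) ^ M =
        4 ^ M * ((2 * z : ℝ) : ℂ) ^ (-(lam + 2 * M) - 2 * α) := by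
      rw [show -lam - 2 * α = (-(lam + 2 * M) - 2 * α) + ((2 * M : ℕ) : ℂ) by push_cast; ring,
        Complex.cpow_add _ _ hz0, Complex.cpow_natCast]
      push_cast
      rw [pow_mul, mul_assoc, ← mul_pow, mul_comm]
      congr 2
      field_simp
      norm_num
    rw [hG]
    linear_combination (Complex.exp ((Real.pi : ℂ) * Complex.I * α) *
      (Complex.Gamma (lam + 2 * α) / Complex.Gamma α) *
      ((ascPochhammer ℂ M).eval (lam / 2 + α + 1 / 2) * (ascPochhammer ℂ M).eval (lam / 2 + α)) *
      (∑' n, kpHC ((lam + 2 * M) / 2 + α + 1 / 2) ((lam + 2 * M) / 2 + α) (lam + 2 * M + α + 1) n *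
          ((1 / z ^ 2 : ℝ) : ℂ) ^ n)) * hpw
  · intro n hn
    have hn' : n + 1 ≤ M := by simpa using hn
    obtain ⟨k, hk⟩ := Nat.exists_eq_add_of_le hn'
    have : lam + α + 1 + (n : ℂ) = -(k : ℂ) := by
      have : (M : ℂ) = n + 1 + k := by rw [hk]; push_cast; ring
      rw [this] at hM
      linear_combination hM
    unfold kpHC
    rw [this, Complex.Gamma_neg_nat_eq_zero]
    simp

lemma kp_Gamma_shift (lam α : ℂ) (h : 0 < (lam + 2 * α).re) (M : ℕ)
    (hM : lam + α + M = 0) (hl : -1 < (lam + 2 * M).re) :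
    Complex.Gamma (lam + 2 * α) / Complex.Gamma (lam + 1) =
      Complex.Gamma (lam + 2 * M + 2 * α) / Complex.Gamma (lam + 2 * M + 1) := by
  obtain rfl : lam = -α - M := by linear_combination hM
  simp at h hl
  have n1 : Complex.Gamma (-α - M + 1) ≠ 0 := by
    refine Complex.Gamma_ne_zero fun m hm => ?_
    have := congrArg Complex.re hm
    simp at this
    have h1 : (m : ℝ) < 2 * M := by linarith
    have h2 : (2 * M : ℝ) < m + 1 := by linarith
    have h1' : m < 2 * M := by exact_mod_cast h1
    have h2' : 2 * M < m + 1 := by exact_mod_cast h2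
    omega
  have n2 : Complex.Gamma (-α - M + 2 * M + 1) ≠ 0 :=
    Complex.Gamma_ne_zero_of_re_pos (by simp; linarith)
  rw [div_eq_div_iff n1 n2]
  have r1 := Complex.Gamma_mul_Gamma_one_sub (α - M)
  have r2 := Complex.Gamma_mul_Gamma_one_sub (α + M)
  rw [show -α - M + 2 * α = α - M by ring, show -α - M + 2 * M + 1 = 1 - (α - M) by ring,
    show -α - M + 2 * M + 2 * α = α + M by ring, show -α - M + 1 = 1 - (α + M) by ring, r1, r2]
  congr 1
  rw [show (Real.pi : ℂ) * (α + M) = Real.pi * (α - M) + M * (2 * Real.pi) by ring,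
    Complex.sin_add_nat_mul_two_pi]


/-- Kernel-form product formula for two Gegenbauer functions of the
second kind. -/
theorem gegenbauerDD_kernel_product
    (lam α : ℂ) (h : 0 < (lam + 2 * α).re)
    (z₁ z₂ : ℝ) (hz₁ : 1 < z₁) (hz₂ : 1 < z₂)
    (F : ℝ → ℂ)
    (hF : ∀ z₃, F z₃ = gegenbauerD lam α z₃ *
        (((z₁ ^ 2 + z₂ ^ 2 + z₃ ^ 2 - 1) / (2 * z₁ * z₂) - z₃ : ℝ) : ℂ) ^ (α - 1))
    (hint : IntegrableOn F (Ioi (z₁ * z₂ + Real.sqrt ((z₁ ^ 2 - 1) * (z₂ ^ 2 - 1))))) :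
    gegenbauerD lam α z₁ * gegenbauerD lam α z₂ =
      Complex.exp ((Real.pi : ℂ) * Complex.I * α) * Complex.Gamma (lam + 2 * α) *
          ((z₁ * z₂ : ℝ) : ℂ) ^ (α - 1) /
        ((2 : ℂ) ^ α * Complex.Gamma (lam + 1) * Complex.Gamma α ^ 2 *
          ((z₁ ^ 2 - 1 : ℝ) : ℂ) ^ (α - 1 / 2) * ((z₂ ^ 2 - 1 : ℝ) : ℂ) ^ (α - 1 / 2)) *
        ∫ z₃ in Ioi (z₁ * z₂ + Real.sqrt ((z₁ ^ 2 - 1) * (z₂ ^ 2 - 1))), F z₃ := by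
  have hsq : (z₁ ^ 2 - 1) * (z₂ ^ 2 - 1) = (z₁ * z₂) ^ 2 - (z₁ ^ 2 + z₂ ^ 2 - 1) := by ring
  rw [hsq] at hint ⊢
  obtain rfl : F = fun z₃ => gegenbauerD lam α z₃ *
        (((z₁ ^ 2 + z₂ ^ 2 + z₃ ^ 2 - 1) / (2 * z₁ * z₂) - z₃ : ℝ) : ℂ) ^ (α - 1) := funext hF
  by_cases hα : ∀ j : ℕ, α ≠ -j
  · by_cases hc : ∀ n : ℕ, lam + α + 1 + n ≠ 0
    · exact (kp_case2 lam α h hα hc z₁ z₂ hz₁ hz₂ hint).2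
    · push Not at hc
      obtain ⟨m, hm⟩ := hc
      have hM : lam + α + ((m + 1 : ℕ) : ℂ) = 0 := by push_cast; linear_combination hm
      generalize m + 1 = M at hM
      have hp : 1 < z₁ * z₂ := by nlinarith
      have hD : EqOn (fun z₃ => gegenbauerD lam α z₃ *
          (((z₁ ^ 2 + z₂ ^ 2 + z₃ ^ 2 - 1) / (2 * z₁ * z₂) - z₃ : ℝ) : ℂ) ^ (α - 1))
          (fun z₃ => gegenbauerD (lam + 2 * M) α z₃ *
          (((z₁ ^ 2 + z₂ ^ 2 + z₃ ^ 2 - 1) / (2 * z₁ * z₂) - z₃ : ℝ) : ℂ) ^ (α - 1))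
          (Ioi (z₁ * z₂ + √((z₁ * z₂) ^ 2 - (z₁ ^ 2 + z₂ ^ 2 - 1)))) := by
        intro z hz
        have hz' : z₁ * z₂ + √((z₁ * z₂) ^ 2 - (z₁ ^ 2 + z₂ ^ 2 - 1)) < z := hz
        have h0 := Real.sqrt_nonneg ((z₁ * z₂) ^ 2 - (z₁ ^ 2 + z₂ ^ 2 - 1))
        simp only
        rw [kp_D_shift lam α h M hM (by linarith : 1 < z)]
      have hint' := hint.congr_fun hD measurableSet_Ioi
      have h' : 0 < (lam + 2 * M + 2 * α).re := by
        simp at h ⊢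
        linarith [Nat.cast_nonneg (α := ℝ) M]
      obtain ⟨hl, key⟩ := kp_case2 (lam + 2 * M) α h' hα (fun n hn => by
        have : (M : ℂ) + 1 + n = 0 := by linear_combination hn - hM
        have h2 : ((M + 1 + n : ℕ) : ℂ) = 0 := by push_cast; exact this
        rw [Nat.cast_eq_zero] at h2
        omega) z₁ z₂ hz₁ hz₂ hint'
      rw [setIntegral_congr_fun measurableSet_Ioi hD, kp_D_shift lam α h M hM hz₁,
        kp_D_shift lam α h M hM hz₂, key]
      have hg := kp_Gamma_shift lam α h M hM hl
      congr 1
      calc _ = Complex.exp ((Real.pi : ℂ) * Complex.I * α) * ((z₁ * z₂ : ℝ) : ℂ) ^ (α - 1) *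
          (Complex.Gamma (lam + 2 * M + 2 * α) / Complex.Gamma (lam + 2 * M + 1)) /
          ((2 : ℂ) ^ α * Complex.Gamma α ^ 2 *
          ((z₁ ^ 2 - 1 : ℝ) : ℂ) ^ (α - 1 / 2) * ((z₂ ^ 2 - 1 : ℝ) : ℂ) ^ (α - 1 / 2)) := by
            simp only [div_eq_mul_inv, mul_inv]; ring
        _ = _ := by
            rw [← hg]
            simp only [div_eq_mul_inv, mul_inv]; ring
  · push Not at hα
    obtain ⟨j, rfl⟩ := hα
    simp [gegenbauerD, Complex.Gamma_neg_nat_eq_zero]
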